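/- arXiv:1611.10289 — 9 statements merged into one kernel-verified Lean document; each statement's English description precedes it below -/
import Mathlib

section
/- Let (δ_n), (h_n) be real sequences and (γ_n) a sequence of strictly positive reals. Then the infinite product measures ⊗_{n∈ℕ} μ(δ_n, γ_n) and ⊗_{n∈ℕ} μ(δ_n + h_n, γ_n) on ℝ^ℕ are mutually absolutely continuous (equivalent) if and only if ∑_{n} (h_n/γ_n)² < ∞. -/
open MeasureTheory Real

/-- The Cauchy measure on `ℝ` with location parameter `δ` and scale parameter `γ`. -/
noncomputable def cauchyMeasure (δ γ : ℝ) : Measure ℝ :=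
  volume.withDensity fun x => ENNReal.ofReal (γ / (π * ((x - δ) ^ 2 + γ ^ 2)))

open ProbabilityTheory hiding cauchyMeasure
open Filter Topology ENNReal

section Product

variable {ι : Type*} {X : ι → Type*} [∀ i, MeasurableSpace (X i)]

theorem lintegral_pi_prod_eq_prod_lintegral [Fintype ι] (μ : ∀ i, Measure (X i))
    [∀ i, IsProbabilityMeasure (μ i)] {f : ∀ i, X i → ℝ≥0∞} (hf : ∀ i, Measurable (f i)) :
    ∫⁻ x, ∏ i, f i (x i) ∂Measure.pi μ = ∏ i, ∫⁻ x, f i x ∂μ i := by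
  have hind : iIndepFun (fun i (x : ∀ i, X i) => f i (x i)) (Measure.pi μ) :=
    iIndepFun_pi fun i => (hf i).aemeasurable
  have := lintegral_prod_eq_prod_lintegral_of_indepFun Finset.univ _ hind
    fun i => (hf i).comp (measurable_pi_apply i)
  rw [this]
  refine Finset.prod_congr rfl fun i _ => ?_
  exact (measurePreserving_eval μ i).lintegral_comp (hf i)

theorem pi_withDensity [Fintype ι] (μ : ∀ i, Measure (X i))
    [∀ i, IsProbabilityMeasure (μ i)] {f : ∀ i, X i → ℝ≥0∞} (hf : ∀ i, Measurable (f i))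
    [∀ i, SigmaFinite ((μ i).withDensity (f i))] :
    Measure.pi (fun i => (μ i).withDensity (f i)) =
      (Measure.pi μ).withDensity fun x => ∏ i, f i (x i) := by
  classical
  refine Measure.pi_eq fun s hs => ?_
  rw [withDensity_apply _ (MeasurableSet.univ_pi hs),
    ← lintegral_indicator (MeasurableSet.univ_pi hs)]
  have hprod : ((Set.univ.pi s).indicator fun x => ∏ i, f i (x i)) =
      fun x => ∏ i, (s i).indicator (f i) (x i) := by
    ext x
    by_cases hx : x ∈ Set.univ.pi s
    · rw [Set.indicator_of_mem hx]
      exact Finset.prod_congr rfl fun i _ => (Set.indicator_of_mem (hx i trivial) _).symm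
    · rw [Set.indicator_of_notMem hx]
      obtain ⟨i, hi⟩ : ∃ i, x i ∉ s i := by simpa [Set.mem_univ_pi] using hx
      exact (Finset.prod_eq_zero (Finset.mem_univ i) (Set.indicator_of_notMem hi _)).symm
  rw [hprod, lintegral_pi_prod_eq_prod_lintegral μ fun i => (hf i).indicator (hs i)]
  refine Finset.prod_congr rfl fun i _ => ?_
  rw [lintegral_indicator (hs i), withDensity_apply _ (hs i)]

theorem withDensity_apply_le_mul_add_div {Ω : Type*} [MeasurableSpace Ω] (μ : Measure Ω)
    {f : Ω → ℝ≥0∞} (hf : Measurable f) {s : Set Ω} (hs : MeasurableSet s) {K : ℝ≥0∞}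
    (hK₀ : K ≠ 0) (hK : K ≠ ⊤) :
    μ.withDensity f s ≤ K * μ s + (∫⁻ x, f x ^ 2 ∂μ) / K := by
  have hle : ∀ x, f x ≤ K + f x ^ 2 * K⁻¹ := fun x => by
    rcases le_total (f x) K with h | h
    · exact h.trans le_self_add
    · calc f x = f x * K * K⁻¹ := by rw [mul_assoc, ENNReal.mul_inv_cancel hK₀ hK, mul_one]
        _ ≤ f x ^ 2 * K⁻¹ := by rw [sq]; gcongr
        _ ≤ _ := le_add_self
  calc μ.withDensity f s = ∫⁻ x in s, f x ∂μ := withDensity_apply _ hs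
    _ ≤ ∫⁻ x in s, (K + f x ^ 2 * K⁻¹) ∂μ := lintegral_mono hle
    _ = K * μ s + (∫⁻ x in s, f x ^ 2 ∂μ) * K⁻¹ := by
        rw [lintegral_add_left measurable_const, setLIntegral_const,
          lintegral_mul_const _ (hf.pow_const 2)]
    _ ≤ _ := by
        rw [div_eq_mul_inv]
        gcongr
        exact Measure.restrict_le_self

/-- Infinite products are absolutely continuous if the second moments of the densities of the
factors have bounded finite products. -/
theorem infinitePi_withDensity_absolutelyContinuous (μ : ∀ i, Measure (X i))
    [∀ i, IsProbabilityMeasure (μ i)] {f : ∀ i, X i → ℝ≥0∞} (hf : ∀ i, Measurable (f i))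
    [∀ i, IsProbabilityMeasure ((μ i).withDensity (f i))] {C : ℝ≥0∞} (hC : C ≠ ⊤)
    (hprod : ∀ I : Finset ι, ∏ i ∈ I, ∫⁻ x, f i x ^ 2 ∂μ i ≤ C) :
    Measure.infinitePi (fun i => (μ i).withDensity (f i)) ≪ Measure.infinitePi μ := by
  set P := Measure.infinitePi μ
  set Q := Measure.infinitePi fun i => (μ i).withDensity (f i)
  have hcyl : ∀ B ∈ measurableCylinders X, ∀ K : ℝ≥0∞, K ≠ 0 → K ≠ ⊤ →
      Q B ≤ K * P B + C / K := by
    intro B hB K hK₀ hK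
    obtain ⟨I, S, hS, rfl⟩ := (mem_measurableCylinders _).mp hB
    rw [Measure.infinitePi_cylinder _ hS, Measure.infinitePi_cylinder _ hS,
      pi_withDensity (fun i : I => μ i) fun i => hf i]
    refine (withDensity_apply_le_mul_add_div _ (by fun_prop) hS hK₀ hK).trans ?_
    gcongr
    simp_rw [← Finset.prod_pow]
    rw [lintegral_pi_prod_eq_prod_lintegral (fun i : I => μ i) (f := fun i x => f i x ^ 2)
      fun i => (hf i).pow_const 2]
    exact (Finset.prod_coe_sort I fun i => ∫⁻ x, f i x ^ 2 ∂μ i).trans_le (hprod I)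
  refine Measure.AbsolutelyContinuous.mk fun A hA hPA => ?_
  have hbound : ∀ n : ℕ, Q A ≤ (1 + C + 1) * ((n + 1 : ℕ) : ℝ≥0∞)⁻¹ := by
    intro n
    set K : ℝ≥0∞ := ((n + 1 : ℕ) : ℝ≥0∞)
    have hK₀ : K ≠ 0 := by simp [K]
    have hK : K ≠ ⊤ := ENNReal.natCast_ne_top _
    have hK1 : K⁻¹ ≤ 1 := ENNReal.inv_le_one.2 (by simp [K])
    have hε : 0 < K⁻¹ * K⁻¹ := by
      rw [pos_iff_ne_zero]; simp [hK]
    obtain ⟨B, hB, hBA⟩ := exists_measure_symmDiff_lt_of_generateFrom_isSetRing (μ := P + Q)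
      isSetRing_measurableCylinders
      ⟨{Set.univ}, Set.countable_singleton _,
        Set.singleton_subset_iff.2 (univ_mem_measurableCylinders X), by simp⟩
      generateFrom_measurableCylinders.symm hA hε
    rw [Measure.add_apply] at hBA
    have hP : P B ≤ K⁻¹ * K⁻¹ := by
      calc P B ≤ P A + P (symmDiff B A) := by
            refine (measure_mono ?_).trans (measure_union_le _ _)
            intro x hx
            by_cases h : x ∈ A
            · exact Or.inl h
            · exact Or.inr (Or.inl ⟨hx, h⟩)
        _ ≤ _ := by rw [hPA, zero_add]; exact le_self_add.trans hBA.le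
    calc Q A ≤ Q B + Q (symmDiff B A) := by
          refine (measure_mono ?_).trans (measure_union_le _ _)
          intro x hx
          by_cases h : x ∈ B
          · exact Or.inl h
          · exact Or.inr (Or.inr ⟨hx, h⟩)
      _ ≤ (K * (K⁻¹ * K⁻¹) + C / K) + K⁻¹ * 1 := by
          gcongr
          · exact (hcyl B hB K hK₀ hK).trans (by gcongr)
          · exact (le_add_self.trans hBA.le).trans (by gcongr)
      _ = (1 + C + 1) * K⁻¹ := by
          rw [← mul_assoc, ENNReal.mul_inv_cancel hK₀ hK, div_eq_mul_inv]; ring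
  have hlim : Tendsto (fun n : ℕ => (1 + C + 1) * ((n + 1 : ℕ) : ℝ≥0∞)⁻¹) atTop (𝓝 0) := by
    have := ENNReal.Tendsto.const_mul (a := 1 + C + 1)
      (ENNReal.tendsto_inv_nat_nhds_zero.comp (tendsto_add_atTop_nat 1))
      (Or.inr (by simp [hC]))
    simpa using this
  exact le_antisymm (ge_of_tendsto' hlim hbound) bot_le

/-- Chebyshev's inequality for linear combinations of indicators of independent coordinates. -/
theorem infinitePi_le_abs_sum_indicator_sub_le (μ : ∀ i, Measure (X i))
    [∀ i, IsProbabilityMeasure (μ i)] {s : ∀ i, Set (X i)} (hs : ∀ i, MeasurableSet (s i))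
    (d : ι → ℝ) (I : Finset ι) {c : ℝ} (hc : 0 < c) :
    Measure.infinitePi μ {x | c ≤ |∑ i ∈ I, d i * (s i).indicator 1 (x i) -
      ∑ i ∈ I, d i * (μ i).real (s i)|} ≤ ENNReal.ofReal ((∑ i ∈ I, d i ^ 2) / 4 / c ^ 2) := by
  set P := Measure.infinitePi μ
  set g : ∀ i, X i → ℝ := fun i x => d i * (s i).indicator 1 x
  have hg : ∀ i, Measurable (g i) := fun i =>
    (measurable_one.indicator (hs i)).const_mul _
  set Y : ι → (∀ i, X i) → ℝ := fun i x => g i (x i)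
  have hY : ∀ i, Measurable (Y i) := fun i => (hg i).comp (measurable_pi_apply i)
  have hbdd : ∀ i x, min 0 (d i) ≤ Y i x ∧ Y i x ≤ max 0 (d i) := by
    intro i x
    by_cases h : x i ∈ s i <;> simp [Y, g, h]
  have hmem : ∀ i, MemLp (Y i) 2 P := fun i =>
    memLp_of_bounded (Eventually.of_forall fun x => hbdd i x) (hY i).aestronglyMeasurable 2
  have hmean : ∀ i, P[Y i] = d i * (μ i).real (s i) := by
    intro i
    calc P[Y i] = ∫ x, g i x ∂μ i := by
          rw [← Measure.infinitePi_map_eval μ i,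
            integral_map (measurable_pi_apply i).aemeasurable (hg i).aestronglyMeasurable]
      _ = _ := by rw [integral_const_mul, integral_indicator_one (hs i)]
  have hvar : ∀ i, variance (Y i) P ≤ d i ^ 2 / 4 := by
    intro i
    refine (variance_le_sq_of_bounded (Eventually.of_forall fun x => hbdd i x)
      (hY i).aemeasurable).trans_eq ?_
    rw [max_sub_min_eq_abs, sub_zero, div_pow, sq_abs]
    norm_num
  have hind : iIndepFun Y P := iIndepFun_infinitePi hg
  have hcheb := meas_ge_le_variance_div_sq (memLp_finsetSum' I fun i _ => hmem i) hc
  have hmeanSum : P[∑ i ∈ I, Y i] = ∑ i ∈ I, d i * (μ i).real (s i) := by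
    simp_rw [Finset.sum_apply]
    rw [integral_finsetSum _ fun i _ => (hmem i).integrable (by norm_num)]
    exact Finset.sum_congr rfl fun i _ => hmean i
  rw [hmeanSum, IndepFun.variance_sum (fun i _ => hmem i)
    fun i _ j _ hij => hind.indepFun hij] at hcheb
  simp_rw [Finset.sum_apply] at hcheb
  refine hcheb.trans (ENNReal.ofReal_le_ofReal ?_)
  gcongr
  rw [Finset.sum_div]
  exact Finset.sum_le_sum fun i _ => hvar i

end Product

theorem summable_sq_sub_of_infinitePi_absolutelyContinuous {X : ℕ → Type*}
    [∀ i, MeasurableSpace (X i)] (μ ν : ∀ i, Measure (X i)) [∀ i, IsProbabilityMeasure (μ i)]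
    [∀ i, IsProbabilityMeasure (ν i)] (hac : Measure.infinitePi μ ≪ Measure.infinitePi ν)
    {s : ∀ i, Set (X i)} (hs : ∀ i, MeasurableSet (s i)) :
    Summable fun i => ((μ i).real (s i) - (ν i).real (s i)) ^ 2 := by
  by_contra hsum
  set P := Measure.infinitePi μ
  set Q := Measure.infinitePi ν
  set d : ℕ → ℝ := fun i => (μ i).real (s i) - (ν i).real (s i)
  have htop := (not_summable_iff_tendsto_nat_atTop_of_nonneg fun i => sq_nonneg (d i)).1 hsum
  choose N hN using fun n : ℕ => (htop.eventually_ge_atTop ((2 : ℝ) ^ n)).exists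
  set D : ℕ → ℝ := fun n => ∑ i ∈ Finset.range (N n), d i ^ 2
  have hDpos : ∀ n, 0 < D n := fun n => (by positivity : (0 : ℝ) < 2 ^ n).trans_le (hN n)
  set S : ℕ → (∀ i, X i) → ℝ := fun n x =>
    ∑ i ∈ Finset.range (N n), d i * (s i).indicator 1 (x i)
  set mean : (∀ i, Measure (X i)) → ℕ → ℝ := fun ρ n =>
    ∑ i ∈ Finset.range (N n), d i * (ρ i).real (s i)
  have hmean : ∀ n, mean μ n - mean ν n = D n := fun n => by
    simp only [mean, D, ← Finset.sum_sub_distrib]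
    exact Finset.sum_congr rfl fun i _ => by simp only [d]; ring
  have hsmall : ∀ (ρ : ∀ i, Measure (X i)) [∀ i, IsProbabilityMeasure (ρ i)],
      ∀ᵐ x ∂Measure.infinitePi ρ, ∀ᶠ n in atTop, |S n x - mean ρ n| < D n / 2 := by
    intro ρ _
    have hle : ∀ n, Measure.infinitePi ρ {x | D n / 2 ≤ |S n x - mean ρ n|} ≤
        ENNReal.ofReal ((1 / 2) ^ n) := by
      intro n
      refine (infinitePi_le_abs_sum_indicator_sub_le ρ hs d _ (half_pos (hDpos n))).trans
        (ENNReal.ofReal_le_ofReal ?_)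
      change D n / 4 / (D n / 2) ^ 2 ≤ _
      have : D n / 4 / (D n / 2) ^ 2 = 1 / D n := by
        have := (hDpos n).ne'
        field_simp
        norm_num
      rw [this, one_div_pow]
      exact one_div_le_one_div_of_le (by positivity) (hN n)
    have hfin : ∑' n, Measure.infinitePi ρ {x | D n / 2 ≤ |S n x - mean ρ n|} ≠ ⊤ := by
      refine ne_top_of_le_ne_top ?_ (ENNReal.tsum_le_tsum hle)
      rw [← ENNReal.ofReal_tsum_of_nonneg (fun n => by positivity) summable_geometric_two]
      exact ENNReal.ofReal_ne_top
    filter_upwards [ae_eventually_notMem hfin] with x hx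
    filter_upwards [hx] with n hn
    simpa using hn
  obtain ⟨x, hμ, hν⟩ := ((hsmall μ).and (hac.ae_le (hsmall ν))).exists
  obtain ⟨n, h₁, h₂⟩ := (hμ.and hν).exists
  have := hmean n
  rw [abs_lt] at h₁ h₂
  linarith [h₁.1, h₂.2]

section Cauchy

variable {γ : ℝ}

theorem cauchyPDFReal_eq_div (δ : ℝ) (γ : NNReal) (x : ℝ) :
    cauchyPDFReal δ γ x = γ / (π * ((x - δ) ^ 2 + (γ : ℝ) ^ 2)) := by
  rw [cauchyPDFReal_def, div_eq_mul_inv, mul_inv]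
  ring

theorem integrable_cauchy_density (δ : ℝ) (hγ : 0 < γ) :
    Integrable fun x => γ / (π * ((x - δ) ^ 2 + γ ^ 2)) := by
  lift γ to NNReal using hγ.le
  simpa only [← cauchyPDFReal_eq_div] using integrable_cauchyPDFReal δ

theorem integral_cauchy_density (δ : ℝ) (hγ : 0 < γ) :
    ∫ x, γ / (π * ((x - δ) ^ 2 + γ ^ 2)) = 1 := by
  lift γ to NNReal using hγ.le
  simpa only [← cauchyPDFReal_eq_div] using
    integral_cauchyPDFReal_eq_one δ (NNReal.coe_pos.1 hγ).ne'

theorem isProbabilityMeasure_cauchyMeasure (δ : ℝ) (hγ : 0 < γ) :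
    IsProbabilityMeasure (cauchyMeasure δ γ) := by
  refine ⟨?_⟩
  rw [cauchyMeasure, withDensity_apply _ MeasurableSet.univ, Measure.restrict_univ,
    ← ofReal_integral_eq_lintegral_ofReal (integrable_cauchy_density δ hγ)
      (Eventually.of_forall fun x => by positivity),
    integral_cauchy_density δ hγ, ENNReal.ofReal_one]

theorem cauchyMeasure_real_Iic (δ a : ℝ) (hγ : 0 < γ) :
    (cauchyMeasure δ γ).real (Set.Iic a) = arctan ((a - δ) / γ) / π + 1 / 2 := by
  have hint := integrable_cauchy_density δ hγ
  rw [measureReal_def, cauchyMeasure, withDensity_apply _ measurableSet_Iic,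
    ← ofReal_integral_eq_lintegral_ofReal hint.integrableOn
      (Eventually.of_forall fun x => by positivity),
    ENNReal.toReal_ofReal (integral_nonneg fun x => by positivity)]
  have hderiv : ∀ x ∈ Set.Iic a, HasDerivAt (fun x => arctan ((x - δ) / γ) / π)
      (γ / (π * ((x - δ) ^ 2 + γ ^ 2))) x := by
    intro x _
    convert! ((((hasDerivAt_id x).sub_const δ).div_const γ).arctan).div_const π using 1
    simp only [id]
    have : (x - δ) ^ 2 + γ ^ 2 ≠ 0 := by positivity
    have : 1 + ((x - δ) / γ) ^ 2 ≠ 0 := by positivity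
    field_simp
    ring
  have hlim : Tendsto (fun x => arctan ((x - δ) / γ) / π) atBot (𝓝 (-(π / 2) / π)) := by
    refine Tendsto.div_const (((tendsto_arctan_atBot).mono_right nhdsWithin_le_nhds).comp ?_) π
    exact (tendsto_atBot_add_const_right atBot (-δ) tendsto_id).atBot_div_const hγ
  rw [integral_Iic_of_hasDerivAt_of_tendsto' hderiv hint.integrableOn hlim]
  field_simp
  ring

theorem cauchyMeasure_add_eq_withDensity (δ h : ℝ) (hγ : 0 < γ) :
    cauchyMeasure (δ + h) γ = (cauchyMeasure δ γ).withDensity fun x =>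
      ENNReal.ofReal (((x - δ) ^ 2 + γ ^ 2) / ((x - (δ + h)) ^ 2 + γ ^ 2)) := by
  rw [cauchyMeasure, cauchyMeasure, ← withDensity_mul _ (by fun_prop) (by fun_prop)]
  congr 1
  ext x
  rw [Pi.mul_apply, ← ENNReal.ofReal_mul (by positivity)]
  congr 1
  field_simp

theorem integrable_div_sq_add_sq_sq (m : ℝ) (hγ : 0 < γ) :
    Integrable fun x => (x - m) / ((x - m) ^ 2 + γ ^ 2) ^ 2 := by
  refine ((integrable_cauchy_density m hγ).const_mul (π / (2 * γ ^ 2))).mono'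
    (Measurable.aestronglyMeasurable (by fun_prop)) (Eventually.of_forall fun x => ?_)
  have hpos : 0 < (x - m) ^ 2 + γ ^ 2 := by positivity
  rw [Real.norm_eq_abs, abs_div, abs_of_pos (pow_pos hpos 2), div_le_iff₀ (pow_pos hpos 2)]
  have : π / (2 * γ ^ 2) * (γ / (π * ((x - m) ^ 2 + γ ^ 2))) * ((x - m) ^ 2 + γ ^ 2) ^ 2 =
      ((x - m) ^ 2 + γ ^ 2) / (2 * γ) := by
    field_simp
  rw [this, le_div_iff₀ (by positivity)]
  nlinarith [sq_nonneg (|x - m| - γ), sq_abs (x - m)]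

theorem integral_div_sq_add_sq_sq (m γ : ℝ) :
    ∫ x, (x - m) / ((x - m) ^ 2 + γ ^ 2) ^ 2 = 0 := by
  rw [integral_sub_right_eq_self (fun x : ℝ => x / (x ^ 2 + γ ^ 2) ^ 2) m]
  have h := integral_neg_eq_self (fun x : ℝ => x / (x ^ 2 + γ ^ 2) ^ 2) volume
  simp only [neg_sq, neg_div, integral_neg] at h
  linarith

theorem lintegral_cauchy_ratio_sq_le (δ h : ℝ) (hγ : 0 < γ) :
    ∫⁻ x, ENNReal.ofReal (((x - δ) ^ 2 + γ ^ 2) / ((x - (δ + h)) ^ 2 + γ ^ 2)) ^ 2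
      ∂cauchyMeasure δ γ ≤ ENNReal.ofReal (1 + (h / γ) ^ 2) := by
  set G : ℝ → ℝ := fun x => (1 + (h / γ) ^ 2) * (γ / (π * ((x - (δ + h)) ^ 2 + γ ^ 2))) +
    2 * h * γ / π * ((x - (δ + h)) / ((x - (δ + h)) ^ 2 + γ ^ 2) ^ 2)
  have hle : ∀ x, γ / (π * ((x - δ) ^ 2 + γ ^ 2)) *
      (((x - δ) ^ 2 + γ ^ 2) / ((x - (δ + h)) ^ 2 + γ ^ 2)) ^ 2 ≤ G x := by
    intro x
    obtain ⟨y, rfl⟩ : ∃ y, x = y + (δ + h) := ⟨x - (δ + h), by ring⟩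
    have hdiff : G (y + (δ + h)) - γ / (π * ((y + (δ + h) - δ) ^ 2 + γ ^ 2)) *
        (((y + (δ + h) - δ) ^ 2 + γ ^ 2) / ((y + (δ + h) - (δ + h)) ^ 2 + γ ^ 2)) ^ 2 =
        h ^ 2 * y ^ 2 / (γ * π * (y ^ 2 + γ ^ 2) ^ 2) := by
      simp only [G, add_sub_cancel_right]
      have : (y + (δ + h) - δ) ^ 2 + γ ^ 2 ≠ 0 := by positivity
      have : y ^ 2 + γ ^ 2 ≠ 0 := by positivity
      field_simp
      ring
    have : 0 ≤ h ^ 2 * y ^ 2 / (γ * π * (y ^ 2 + γ ^ 2) ^ 2) := by positivity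
    linarith
  have hG₁ := (integrable_cauchy_density (δ + h) hγ).const_mul (1 + (h / γ) ^ 2)
  have hG₂ := (integrable_div_sq_add_sq_sq (δ + h) hγ).const_mul (2 * h * γ / π)
  have hG : Integrable G := hG₁.add hG₂
  have hGint : ∫ x, G x = 1 + (h / γ) ^ 2 := by
    rw [integral_add hG₁ hG₂, integral_const_mul, integral_const_mul,
      integral_cauchy_density _ hγ, integral_div_sq_add_sq_sq]
    ring
  rw [cauchyMeasure, lintegral_withDensity_eq_lintegral_mul _ (by fun_prop) (by fun_prop),
    ← hGint, ofReal_integral_eq_lintegral_ofReal hG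
      (Eventually.of_forall fun x => le_trans (by positivity) (hle x))]
  refine lintegral_mono fun x => ?_
  rw [Pi.mul_apply, ← ENNReal.ofReal_pow (by positivity), ← ENNReal.ofReal_mul (by positivity)]
  exact ENNReal.ofReal_le_ofReal (hle x)

theorem infinitePi_cauchyMeasure_add_absolutelyContinuous {δ h γ : ℕ → ℝ} (hγ : ∀ n, 0 < γ n)
    [∀ n, IsProbabilityMeasure (cauchyMeasure (δ n) (γ n))]
    [∀ n, IsProbabilityMeasure (cauchyMeasure (δ n + h n) (γ n))]
    (hsum : Summable fun n => (h n / γ n) ^ 2) :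
    Measure.infinitePi (fun n => cauchyMeasure (δ n + h n) (γ n)) ≪
      Measure.infinitePi fun n => cauchyMeasure (δ n) (γ n) := by
  have heq := fun n => cauchyMeasure_add_eq_withDensity (δ n) (h n) (hγ n)
  have : ∀ n, IsProbabilityMeasure ((cauchyMeasure (δ n) (γ n)).withDensity fun x =>
      ENNReal.ofReal (((x - δ n) ^ 2 + γ n ^ 2) / ((x - (δ n + h n)) ^ 2 + γ n ^ 2))) :=
    fun n => heq n ▸ inferInstance
  simp_rw [heq]
  refine infinitePi_withDensity_absolutelyContinuous _ (fun n => by fun_prop)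
    (C := ENNReal.ofReal (exp (∑' n, (h n / γ n) ^ 2))) ENNReal.ofReal_ne_top fun I => ?_
  calc _ ≤ ∏ n ∈ I, ENNReal.ofReal (1 + (h n / γ n) ^ 2) :=
        Finset.prod_le_prod' fun n _ => lintegral_cauchy_ratio_sq_le (δ n) (h n) (hγ n)
    _ = ENNReal.ofReal (∏ n ∈ I, (1 + (h n / γ n) ^ 2)) :=
        (ENNReal.ofReal_prod_of_nonneg fun n _ => by positivity).symm
    _ ≤ ENNReal.ofReal (∏ n ∈ I, exp ((h n / γ n) ^ 2)) := by
        refine ENNReal.ofReal_le_ofReal (Finset.prod_le_prod (fun n _ => by positivity)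
          fun n _ => ?_)
        rw [add_comm]
        exact add_one_le_exp _
    _ ≤ _ := by
        rw [← exp_sum]
        gcongr
        exact hsum.sum_le_tsum I fun n _ => sq_nonneg _

end Cauchy

theorem summable_sq_of_summable_sq_arctan {t : ℕ → ℝ}
    (ht : Summable fun n => arctan (t n) ^ 2) : Summable fun n => t n ^ 2 := by
  have hlim : Tendsto (fun n => arctan (t n)) atTop (𝓝 0) := by
    have := ht.tendsto_atTop_zero.sqrt
    simp only [sqrt_sq_eq_abs, sqrt_zero] at this
    exact (tendsto_zero_iff_abs_tendsto_zero _).2 this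
  have htan : (fun y : ℝ => tan y) =O[𝓝 0] fun y => y := by
    simpa using (hasDerivAt_tan (x := 0) (by simp)).isBigO_sub
  have hO : t =O[atTop] fun n => arctan (t n) := by
    simpa [Function.comp_def, tan_arctan] using htan.comp_tendsto hlim
  exact summable_of_isBigO_nat ht (hO.pow 2)

theorem cauchy_product_equivalent_iff_translations
    (δ h γ : ℕ → ℝ) (hγ : ∀ n, 0 < γ n)
    (P Q : Measure (ℕ → ℝ))
    (hP : IsProjectiveLimit P fun I : Finset ℕ =>
      Measure.pi fun i : I => cauchyMeasure (δ i.1) (γ i.1))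
    (hQ : IsProjectiveLimit Q fun I : Finset ℕ =>
      Measure.pi fun i : I => cauchyMeasure (δ i.1 + h i.1) (γ i.1)) :
    (P ≪ Q ∧ Q ≪ P) ↔ Summable fun n => (h n / γ n) ^ 2 := by
  have hμ := fun n => isProbabilityMeasure_cauchyMeasure (δ n) (hγ n)
  have hν := fun n => isProbabilityMeasure_cauchyMeasure (δ n + h n) (hγ n)
  obtain rfl := hP.unique
    (Measure.isProjectiveLimit_infinitePi fun n => cauchyMeasure (δ n) (γ n))
  obtain rfl := hQ.unique
    (Measure.isProjectiveLimit_infinitePi fun n => cauchyMeasure (δ n + h n) (γ n))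
  refine ⟨fun hac => ?_, fun hsum => ⟨?_, ?_⟩⟩
  · have hsq := summable_sq_sub_of_infinitePi_absolutelyContinuous _ _ hac.1
      (s := fun n => Set.Iic (δ n)) fun n => measurableSet_Iic
    refine summable_sq_of_summable_sq_arctan ((hsq.mul_left (π ^ 2)).congr fun n => ?_)
    rw [cauchyMeasure_real_Iic _ _ (hγ n), cauchyMeasure_real_Iic _ _ (hγ n), sub_self,
      sub_add_cancel_left, neg_div, arctan_neg, zero_div, arctan_zero]
    field_simp
    ring
  · have hback : ∀ n, δ n + h n + -h n = δ n := fun n => by ring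
    have : ∀ n, IsProbabilityMeasure (cauchyMeasure (δ n + h n + -h n) (γ n)) :=
      fun n => by rw [hback]; exact hμ n
    have hac := infinitePi_cauchyMeasure_add_absolutelyContinuous
      (δ := fun n => δ n + h n) (h := fun n => -h n) hγ (by simpa [neg_div] using hsum)
    simpa only [hback] using hac
  · exact infinitePi_cauchyMeasure_add_absolutelyContinuous hγ hsum
end

section
/- Let r, s be natural numbers with r ≤ s − 1 (in particular s ≥ 1). Then ∫_ℝ x^{2r}/(x² + 1)^s dx = π · (2r)! · (2(s−r−1))! / (4^{s−1} · r! · (s−r−1)! · (s−1)!). -/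
open Real

open MeasureTheory Filter Topology

lemma pow_div_pow_sq_add_one_le (r m : ℕ) (x : ℝ) :
    x ^ (2 * r) / (x ^ 2 + 1) ^ (r + m + 1) ≤ (1 + x ^ 2)⁻¹ := by
  have h : (0 : ℝ) < x ^ 2 + 1 := by positivity
  have h1 : x ^ (2 * r) ≤ (x ^ 2 + 1) ^ (r + m) := by
    rw [pow_mul]
    calc (x ^ 2) ^ r ≤ (x ^ 2 + 1) ^ r := by gcongr; linarith
      _ ≤ (x ^ 2 + 1) ^ (r + m) := pow_le_pow_right₀ (by nlinarith) (by omega)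
  rw [pow_succ, inv_eq_one_div, add_comm 1 (x ^ 2), div_le_div_iff₀ (by positivity) h]
  nlinarith

lemma integrable_pow_div_pow_sq_add_one (r m : ℕ) :
    Integrable fun x : ℝ ↦ x ^ (2 * r) / (x ^ 2 + 1) ^ (r + m + 1) := by
  refine integrable_inv_one_add_sq.mono' ?_ (.of_forall fun x ↦ ?_)
  · exact (Continuous.div (by fun_prop) (by fun_prop) fun x ↦ by positivity).aestronglyMeasurable
  · rw [pow_mul, norm_of_nonneg (by positivity), ← pow_mul]
    exact pow_div_pow_sq_add_one_le r m x

lemma norm_odd_pow_div_pow_sq_add_one_le (r m : ℕ) (x : ℝ) :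
    ‖x ^ (2 * r + 1) / (x ^ 2 + 1) ^ (r + m + 1)‖ ≤ ‖x⁻¹‖ := by
  have h := pow_div_pow_sq_add_one_le r m x
  have h0 : 0 ≤ x ^ (2 * r) / (x ^ 2 + 1) ^ (r + m + 1) := by
    rw [pow_mul]; positivity
  rw [pow_succ, mul_div_right_comm, norm_mul, norm_of_nonneg h0]
  rcases eq_or_ne x 0 with rfl | hx
  · simp
  calc _ ≤ (1 + x ^ 2)⁻¹ * ‖x‖ := by gcongr
    _ ≤ (x ^ 2)⁻¹ * ‖x‖ := by gcongr; linarith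
    _ = ‖x⁻¹‖ := by
      rw [norm_inv, ← sq_abs, norm_eq_abs]
      field_simp

lemma integral_pow_div_pow_sq_add_one_succ_left (r m : ℕ) :
    (2 * r + 1 : ℝ) * ∫ x : ℝ, x ^ (2 * r) / (x ^ 2 + 1) ^ (r + m + 1) =
      (2 * (r + m + 1) : ℝ) * ∫ x : ℝ, x ^ (2 * (r + 1)) / (x ^ 2 + 1) ^ (r + 1 + m + 1) := by
  have hderiv (x : ℝ) : HasDerivAt (fun x : ℝ ↦ x ^ (2 * r + 1) / (x ^ 2 + 1) ^ (r + m + 1))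
      ((2 * r + 1) * (x ^ (2 * r) / (x ^ 2 + 1) ^ (r + m + 1)) -
        2 * (r + m + 1) * (x ^ (2 * (r + 1)) / (x ^ 2 + 1) ^ (r + 1 + m + 1))) x := by
    have h : x ^ 2 + 1 ≠ 0 := by positivity
    refine ((hasDerivAt_pow (2 * r + 1) x).div
      (((hasDerivAt_pow 2 x).add_const 1).pow (r + m + 1)) (pow_ne_zero _ h)).congr_deriv ?_
    rw [show r + 1 + m + 1 = r + m + 1 + 1 by ring]
    simp only [Nat.add_sub_cancel, Pi.pow_apply]
    push_cast
    field_simp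
    ring
  have h₁ := (integrable_pow_div_pow_sq_add_one r m).const_mul (2 * r + 1 : ℝ)
  have h₂ := (integrable_pow_div_pow_sq_add_one (r + 1) m).const_mul (2 * (r + m + 1) : ℝ)
  have h := integral_of_hasDerivAt_of_tendsto hderiv (h₁.sub h₂)
    (squeeze_zero_norm (norm_odd_pow_div_pow_sq_add_one_le r m)
      (tendsto_norm_zero.comp tendsto_inv_atBot_zero))
    (squeeze_zero_norm (norm_odd_pow_div_pow_sq_add_one_le r m)
      (tendsto_norm_zero.comp tendsto_inv_atTop_zero))
  rw [integral_sub h₁ h₂, integral_const_mul, integral_const_mul] at h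
  linarith

lemma integral_pow_div_pow_sq_add_one_eq_add (r m : ℕ) :
    ∫ x : ℝ, x ^ (2 * r) / (x ^ 2 + 1) ^ (r + m + 1) =
      (∫ x : ℝ, x ^ (2 * (r + 1)) / (x ^ 2 + 1) ^ (r + 1 + m + 1)) +
        ∫ x : ℝ, x ^ (2 * r) / (x ^ 2 + 1) ^ (r + (m + 1) + 1) := by
  rw [← integral_add (integrable_pow_div_pow_sq_add_one (r + 1) m)
    (integrable_pow_div_pow_sq_add_one r (m + 1))]
  congr 1 with x
  have h : x ^ 2 + 1 ≠ 0 := by positivity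
  rw [show r + 1 + m + 1 = r + m + 1 + 1 by ring, show r + (m + 1) + 1 = r + m + 1 + 1 by ring]
  field_simp
  ring

lemma integral_pow_div_pow_sq_add_one_add (r m : ℕ) :
    ∫ x : ℝ, x ^ (2 * r) / (x ^ 2 + 1) ^ (r + m + 1) =
      π * (2 * r).factorial * (2 * m).factorial /
        (4 ^ (r + m) * r.factorial * m.factorial * (r + m).factorial) := by
  induction r with
  | zero =>
    induction m with
    | zero => simpa [add_comm] using integral_univ_inv_one_add_sq
    | succ m ih =>
      have h₁ := integral_pow_div_pow_sq_add_one_succ_left 0 m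
      have h₂ := integral_pow_div_pow_sq_add_one_eq_add 0 m
      have h : ∫ x : ℝ, x ^ (2 * 0) / (x ^ 2 + 1) ^ (0 + (m + 1) + 1) =
          ((2 * m + 1) / (2 * (m + 1)) : ℝ) *
            ∫ x : ℝ, x ^ (2 * 0) / (x ^ 2 + 1) ^ (0 + m + 1) := by
        rw [div_mul_eq_mul_div, eq_div_iff (by positivity)]
        rw [Nat.cast_zero] at h₁
        linear_combination (-2 * (m + 1) : ℝ) * h₂ + h₁
      rw [h, ih]
      simp only [mul_add, mul_one, zero_add, Nat.factorial_succ, pow_succ]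
      push_cast
      field_simp
      ring
  | succ r ih =>
    have h₁ := integral_pow_div_pow_sq_add_one_succ_left r m
    have h : ∫ x : ℝ, x ^ (2 * (r + 1)) / (x ^ 2 + 1) ^ (r + 1 + m + 1) =
        ((2 * r + 1) / (2 * (r + m + 1)) : ℝ) *
          ∫ x : ℝ, x ^ (2 * r) / (x ^ 2 + 1) ^ (r + m + 1) := by
      rw [div_mul_eq_mul_div, eq_div_iff (by positivity)]
      linarith
    rw [h, ih, show r + 1 + m = r + m + 1 by ring]
    simp only [mul_add, mul_one, Nat.factorial_succ, pow_succ]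
    push_cast
    field_simp
    ring

theorem integral_pow_div_pow_sq_add_one
    (r s : ℕ) (hs : 1 ≤ s) (hr : r ≤ s - 1) :
    ∫ x : ℝ, x ^ (2 * r) / (x ^ 2 + 1) ^ s =
      π * (2 * r).factorial * (2 * (s - r - 1)).factorial /
        (4 ^ (s - 1) * r.factorial * (s - r - 1).factorial * (s - 1).factorial) := by
  obtain ⟨m, rfl⟩ : ∃ m, s = r + m + 1 := ⟨s - r - 1, by omega⟩
  rw [show r + m + 1 - r - 1 = m by omega, Nat.add_sub_cancel]
  exact integral_pow_div_pow_sq_add_one_add r m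
end

section
/- Let δ, h ∈ ℝ, γ > 0, and set ζ = h/γ. Then ∫_ℝ √(φ(x)) dμ(δ,γ)(x) = (1/π) ∫_ℝ 1/(√((y − ζ)² + 1) · √(y² + 1)) dy, where φ(x) = ((x−δ)² + γ²)/((x−δ−h)² + γ²). -/
open MeasureTheory Real

/-- The integral of a real function against the Cauchy measure, after standardizing the variable. -/
theorem integral_cauchyMeasure_eq (δ γ : ℝ) (hγ : 0 < γ) (f : ℝ → ℝ) :
    ∫ x, f x ∂(cauchyMeasure δ γ) = (1 / π) * ∫ y : ℝ, f (γ * y + δ) / (y ^ 2 + 1) := by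
  have hdens (x : ℝ) : (ENNReal.ofReal (γ / (π * ((x - δ) ^ 2 + γ ^ 2)))).toReal • f x =
      (1 / (π * γ)) * (f (γ * ((x - δ) / γ) + δ) / (((x - δ) / γ) ^ 2 + 1)) := by
    rw [ENNReal.toReal_ofReal (by positivity), smul_eq_mul, mul_div_cancel₀ _ hγ.ne',
      sub_add_cancel]
    field_simp
  rw [cauchyMeasure, integral_withDensity_eq_integral_toReal_smul (by fun_prop)
    (ae_of_all _ fun _ => ENNReal.ofReal_lt_top)]
  simp_rw [hdens]
  rw [integral_const_mul,
    integral_sub_right_eq_self (fun x : ℝ => f (γ * (x / γ) + δ) / ((x / γ) ^ 2 + 1)) δ,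
    Measure.integral_comp_div (fun y : ℝ => f (γ * y + δ) / (y ^ 2 + 1)) γ, abs_of_pos hγ,
    smul_eq_mul, ← mul_assoc]
  congr 1
  field_simp

theorem integral_sqrt_rnDeriv_translate (δ h γ : ℝ) (hγ : 0 < γ) :
    ∫ x, Real.sqrt (((x - δ) ^ 2 + γ ^ 2) / ((x - δ - h) ^ 2 + γ ^ 2))
        ∂(cauchyMeasure δ γ) =
      (1 / π) * ∫ y : ℝ,
        1 / (Real.sqrt ((y - h / γ) ^ 2 + 1) * Real.sqrt (y ^ 2 + 1)) := by
  rw [integral_cauchyMeasure_eq δ γ hγ]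
  congr 2 with y
  have hφ : ((γ * y + δ - δ) ^ 2 + γ ^ 2) / ((γ * y + δ - δ - h) ^ 2 + γ ^ 2) =
      (y ^ 2 + 1) / ((y - h / γ) ^ 2 + 1) := by
    rw [div_eq_div_iff (by positivity) (by positivity)]
    field_simp
    ring
  have hy : Real.sqrt (y ^ 2 + 1) ^ 2 = y ^ 2 + 1 := Real.sq_sqrt (by positivity)
  have hpos : 0 < Real.sqrt (y ^ 2 + 1) := by positivity
  have hpos' : 0 < Real.sqrt ((y - h / γ) ^ 2 + 1) := by positivity
  rw [hφ, Real.sqrt_div (by positivity), div_div,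
    div_eq_div_iff (by positivity) (by positivity)]
  linear_combination Real.sqrt ((y - h / γ) ^ 2 + 1) * hy
end

section
/- Let (δ_n), (h_n) be real sequences with h_n ≠ 0 for all n, let (γ_n) be strictly positive, set ζ_n = h_n/γ_n, and suppose ζ_n → 0. Let H_n = ∫_ℝ √(φ_n(x)) dμ(δ_n,γ_n)(x), where φ_n(x) = ((x−δ_n)² + γ_n²)/((x−δ_n−h_n)² + γ_n²). Then for every C > 1/8 there exists N ∈ ℕ such that 0 < 1 − H_n ≤ C ζ_n² for all n ≥ N; in particular H_n → 1 and H_n < 1 for all n. -/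
open MeasureTheory Real Filter

theorem integrable_and_integral_inv_sq_add_sq (m : ℝ) {s : ℝ} (hs : 0 < s) :
    Integrable (fun x : ℝ => ((x - m) ^ 2 + s ^ 2)⁻¹) ∧
      ∫ x : ℝ, ((x - m) ^ 2 + s ^ 2)⁻¹ = π / s := by
  have key : (fun x : ℝ => (x ^ 2 + s ^ 2)⁻¹) =
      fun x : ℝ => (s ^ 2)⁻¹ * (1 + (x / s) ^ 2)⁻¹ := by
    funext x
    rw [← mul_inv]
    congr 1
    field_simp
    ring
  constructor
  · have h0 : Integrable (fun x : ℝ => (x ^ 2 + s ^ 2)⁻¹) := by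
      rw [key]
      exact (integrable_inv_one_add_sq.comp_div hs.ne').const_mul _
    exact h0.comp_sub_right m
  · rw [integral_sub_right_eq_self (fun x : ℝ => (x ^ 2 + s ^ 2)⁻¹) m, key,
      integral_const_mul, Measure.integral_comp_div (fun x : ℝ => (1 + x ^ 2)⁻¹) s,
      integral_univ_inv_one_add_sq, abs_of_pos hs, smul_eq_mul]
    field_simp

theorem integral_cauchyMeasure (f : ℝ → ℝ) (δ : ℝ) {γ : ℝ} (hγ : 0 < γ) :
    ∫ x, f x ∂(cauchyMeasure δ γ) =
      ∫ x, γ / (π * ((x - δ) ^ 2 + γ ^ 2)) * f x := by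
  unfold cauchyMeasure
  rw [integral_withDensity_eq_integral_toReal_smul (by fun_prop) (by simp)]
  congr 1
  funext x
  rw [ENNReal.toReal_ofReal (by positivity), smul_eq_mul]

theorem integral_sqrt_inv_mul_sqrt_inv_bounds (δ : ℝ) {h γ : ℝ} (hh : h ≠ 0) (hγ : 0 < γ) :
    π / √(γ ^ 2 + h ^ 2 / 4) ≤
        ∫ x : ℝ, (√((x - δ) ^ 2 + γ ^ 2))⁻¹ * (√((x - δ - h) ^ 2 + γ ^ 2))⁻¹ ∧
      ∫ x : ℝ, (√((x - δ) ^ 2 + γ ^ 2))⁻¹ * (√((x - δ - h) ^ 2 + γ ^ 2))⁻¹ < π / γ := by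
  set p : ℝ → ℝ := fun x => (√((x - δ) ^ 2 + γ ^ 2))⁻¹ with hp
  set q : ℝ → ℝ := fun x => (√((x - δ - h) ^ 2 + γ ^ 2))⁻¹ with hq
  have hA (x : ℝ) : 0 < (x - δ) ^ 2 + γ ^ 2 := by positivity
  have hB (x : ℝ) : 0 < (x - δ - h) ^ 2 + γ ^ 2 := by positivity
  have pc : Continuous p :=
    Continuous.inv₀ (by fun_prop) fun x => (Real.sqrt_pos.2 (hA x)).ne'
  have qc : Continuous q :=
    Continuous.inv₀ (by fun_prop) fun x => (Real.sqrt_pos.2 (hB x)).ne'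
  have p2 (x : ℝ) : p x ^ 2 = ((x - δ) ^ 2 + γ ^ 2)⁻¹ := by
    rw [hp, inv_pow, Real.sq_sqrt (hA x).le]
  have q2 (x : ℝ) : q x ^ 2 = ((x - (δ + h)) ^ 2 + γ ^ 2)⁻¹ := by
    rw [hq, inv_pow, Real.sq_sqrt (hB x).le, sub_sub]
  have p0 (x : ℝ) : 0 < p x := inv_pos.2 (Real.sqrt_pos.2 (hA x))
  have q0 (x : ℝ) : 0 < q x := inv_pos.2 (Real.sqrt_pos.2 (hB x))
  obtain ⟨ip, ep⟩ := integrable_and_integral_inv_sq_add_sq δ hγ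
  obtain ⟨iq, eq⟩ := integrable_and_integral_inv_sq_add_sq (δ + h) hγ
  simp only [← p2] at ip ep
  simp only [← q2] at iq eq
  have ipq : Integrable (fun x => p x * q x) := by
    refine (ip.add iq).mono' (pc.mul qc).aestronglyMeasurable (ae_of_all _ fun x => ?_)
    have := mul_pos (p0 x) (q0 x)
    rw [Real.norm_of_nonneg this.le, Pi.add_apply]
    nlinarith [sq_nonneg (p x - q x)]
  constructor
  · have hs : 0 < √(γ ^ 2 + h ^ 2 / 4) := by positivity
    obtain ⟨is, es⟩ := integrable_and_integral_inv_sq_add_sq (δ + h / 2) hs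
    rw [← es]
    refine integral_mono is ipq fun x => ?_
    beta_reduce
    rw [← mul_inv, Real.sq_sqrt (by positivity)]
    have h1 := Real.sqrt_pos.2 (hA x)
    have h2 := Real.sqrt_pos.2 (hB x)
    apply inv_anti₀ (mul_pos h1 h2)
    nlinarith [sq_nonneg (√((x - δ) ^ 2 + γ ^ 2) - √((x - δ - h) ^ 2 + γ ^ 2)),
      Real.sq_sqrt (hA x).le, Real.sq_sqrt (hB x).le]
  · have ia : Integrable (fun x => p x ^ 2 + q x ^ 2) := ip.add iq
    have e : (fun x => (p x - q x) ^ 2) = fun x => p x ^ 2 + q x ^ 2 - 2 * (p x * q x) := by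
      funext x; ring
    have i : Integrable (fun x => (p x - q x) ^ 2) := by
      rw [e]; exact ia.sub (ipq.const_mul 2)
    have hne : (p δ - q δ) ^ 2 ≠ 0 := by
      intro h0
      have h1 : p δ = q δ := sub_eq_zero.1 (pow_eq_zero_iff two_ne_zero |>.1 h0)
      have h2 : p δ ^ 2 = q δ ^ 2 := by rw [h1]
      rw [p2, q2, inv_inj] at h2
      apply hh
      have : h ^ 2 = 0 := by linarith
      exact pow_eq_zero_iff two_ne_zero |>.1 this
    have hpos : 0 < ∫ x, (p x - q x) ^ 2 :=
      integral_pos_of_integrable_nonneg_nonzero ((pc.sub qc).pow 2) i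
        (fun x => sq_nonneg _) hne
    rw [e, integral_sub ia (ipq.const_mul 2), integral_add ip iq,
      integral_const_mul, ep, eq] at hpos
    change ∫ x, p x * q x < π / γ
    linarith

theorem integral_sqrt_cauchyMeasure_bounds (δ : ℝ) {h γ : ℝ} (hh : h ≠ 0)
    (hγ : 0 < γ) :
    1 - (h / γ) ^ 2 / 8 ≤
        ∫ x, √(((x - δ) ^ 2 + γ ^ 2) / ((x - δ - h) ^ 2 + γ ^ 2)) ∂(cauchyMeasure δ γ) ∧
      ∫ x, √(((x - δ) ^ 2 + γ ^ 2) / ((x - δ - h) ^ 2 + γ ^ 2)) ∂(cauchyMeasure δ γ) < 1 := by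
  have e : ∫ x, √(((x - δ) ^ 2 + γ ^ 2) / ((x - δ - h) ^ 2 + γ ^ 2)) ∂(cauchyMeasure δ γ) =
      γ / π * ∫ x : ℝ, (√((x - δ) ^ 2 + γ ^ 2))⁻¹ * (√((x - δ - h) ^ 2 + γ ^ 2))⁻¹ := by
    rw [integral_cauchyMeasure _ δ hγ, ← integral_const_mul]
    congr 1
    funext x
    have hA : 0 < (x - δ) ^ 2 + γ ^ 2 := by positivity
    have hB : 0 < (x - δ - h) ^ 2 + γ ^ 2 := by positivity
    have h1 := Real.sqrt_pos.2 hA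
    have h2 := Real.sqrt_pos.2 hB
    rw [Real.sqrt_div hA.le]
    nth_rewrite 1 [← Real.sq_sqrt hA.le]
    field_simp
  obtain ⟨lo, hi⟩ := integral_sqrt_inv_mul_sqrt_inv_bounds δ hh hγ
  have hc : 0 < γ / π := by positivity
  rw [e]
  constructor
  · refine le_trans ?_ (mul_le_mul_of_nonneg_left lo hc.le)
    have hs : 0 < √(γ ^ 2 + h ^ 2 / 4) := by positivity
    have hle : √(γ ^ 2 + h ^ 2 / 4) ≤ γ * (1 + (h / γ) ^ 2 / 8) := by
      apply Real.sqrt_le_iff.2 ⟨by positivity, ?_⟩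
      have : γ ^ 2 + h ^ 2 / 4 = γ ^ 2 * (1 + (h / γ) ^ 2 / 4) := by field_simp
      rw [this, mul_pow]
      gcongr
      nlinarith [sq_nonneg ((h / γ) ^ 2)]
    have : γ / π * (π / √(γ ^ 2 + h ^ 2 / 4)) = γ / √(γ ^ 2 + h ^ 2 / 4) := by
      field_simp
    rw [this, le_div_iff₀ hs]
    set u := (h / γ) ^ 2 / 8 with hu
    have hu0 : 0 ≤ u := by positivity
    rcases le_total u 1 with h1 | h1
    · calc (1 - u) * √(γ ^ 2 + h ^ 2 / 4) ≤ (1 - u) * (γ * (1 + u)) :=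
            mul_le_mul_of_nonneg_left hle (by linarith)
        _ ≤ γ := by nlinarith [mul_nonneg hγ.le (sq_nonneg u)]
    · nlinarith
  · have := mul_lt_mul_of_pos_left hi hc
    rwa [show γ / π * (π / γ) = 1 by field_simp] at this


theorem integral_sqrt_rnDeriv_translate_tendsto_one
    (δ h γ : ℕ → ℝ) (hh : ∀ n, h n ≠ 0) (hγ : ∀ n, 0 < γ n)
    (hζ : Tendsto (fun n => h n / γ n) atTop (nhds 0))
    (H : ℕ → ℝ)
    (hH : ∀ n, H n = ∫ x,
      Real.sqrt (((x - δ n) ^ 2 + γ n ^ 2) / ((x - δ n - h n) ^ 2 + γ n ^ 2))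
        ∂(cauchyMeasure (δ n) (γ n))) :
    (∀ C : ℝ, 1 / 8 < C → ∃ N : ℕ, ∀ n, N ≤ n →
      0 < 1 - H n ∧ 1 - H n ≤ C * (h n / γ n) ^ 2) ∧
    Tendsto H atTop (nhds 1) ∧ ∀ n, H n < 1 := by
  have lo (n : ℕ) : 1 - (h n / γ n) ^ 2 / 8 ≤ H n :=
    hH n ▸ (integral_sqrt_cauchyMeasure_bounds (δ n) (hh n) (hγ n)).1
  have hi (n : ℕ) : H n < 1 :=
    hH n ▸ (integral_sqrt_cauchyMeasure_bounds (δ n) (hh n) (hγ n)).2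
  refine ⟨fun C hC => ⟨0, fun n _ => ⟨sub_pos.2 (hi n), ?_⟩⟩, ?_, hi⟩
  · nlinarith [lo n, sq_nonneg (h n / γ n)]
  · refine tendsto_of_tendsto_of_tendsto_of_le_of_le ?_ tendsto_const_nhds lo fun n => (hi n).le
    simpa using ((hζ.pow 2).div_const 8).const_sub 1
end

section
/- Let (δ_n), (h_n) be real sequences, (γ_n) strictly positive, ζ_n = h_n/γ_n, and H_n = ∫_ℝ √(φ_n(x)) dμ(δ_n,γ_n)(x), where φ_n(x) = ((x−δ_n)² + γ_n²)/((x−δ_n−h_n)² + γ_n²). If the series ∑_{n} (−log H_n) converges, then ζ_n → 0. -/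
open MeasureTheory Real Filter

/-- The product of the square roots of two unit-scale Cauchy profiles centred at `-z` and `z`. -/
noncomputable def cauchyOverlap (z t : ℝ) : ℝ :=
  √((1 + (t + z) ^ 2)⁻¹) * √((1 + (t - z) ^ 2)⁻¹)

lemma cauchyOverlap_pos (z t : ℝ) : 0 < cauchyOverlap z t := by
  unfold cauchyOverlap
  positivity

lemma cauchyOverlap_abs (z t : ℝ) : cauchyOverlap z |t| = cauchyOverlap z t := by
  rcases abs_choice t with h | h
  · rw [h]
  · rw [h]
    unfold cauchyOverlap
    rw [show (-t + z) ^ 2 = (t - z) ^ 2 by ring, show (-t - z) ^ 2 = (t + z) ^ 2 by ring, mul_comm]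

lemma cauchyOverlap_le (z t : ℝ) {c : ℝ} (hc : 0 < c) :
    cauchyOverlap z t ≤ (c * (1 + (t - z) ^ 2)⁻¹ + c⁻¹ * (1 + (t + z) ^ 2)⁻¹) / 2 := by
  unfold cauchyOverlap
  have hp : √((1 + (t + z) ^ 2)⁻¹) ^ 2 = (1 + (t + z) ^ 2)⁻¹ := sq_sqrt (by positivity)
  have hq : √((1 + (t - z) ^ 2)⁻¹) ^ 2 = (1 + (t - z) ^ 2)⁻¹ := sq_sqrt (by positivity)
  generalize √((1 + (t - z) ^ 2)⁻¹) = q at *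
  generalize √((1 + (t + z) ^ 2)⁻¹) = p at *
  rw [← hp, ← hq]
  have h : 0 ≤ c⁻¹ * (c * q - p) ^ 2 := by positivity
  have e : c⁻¹ * (c * q - p) ^ 2 = c * q ^ 2 + c⁻¹ * p ^ 2 - 2 * (p * q) := by
    field_simp
    ring
  linarith

lemma integrable_inv_one_add_add_sq (z : ℝ) : Integrable fun t : ℝ => (1 + (t + z) ^ 2)⁻¹ :=
  integrable_inv_one_add_sq.comp_add_right z

lemma integrable_inv_one_add_sub_sq (z : ℝ) : Integrable fun t : ℝ => (1 + (t - z) ^ 2)⁻¹ :=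
  integrable_inv_one_add_sq.comp_sub_right z

lemma integrable_cauchyOverlap (z : ℝ) : Integrable (cauchyOverlap z) := by
  refine (((integrable_inv_one_add_sub_sq z).const_mul 1).add
    ((integrable_inv_one_add_add_sq z).const_mul 1⁻¹) |>.div_const 2).mono'
    (by unfold cauchyOverlap; fun_prop) (.of_forall fun t => ?_)
  rw [norm_of_nonneg (cauchyOverlap_pos z t).le]
  exact cauchyOverlap_le z t one_pos

lemma integral_cauchyOverlap_pos (z : ℝ) : 0 < ∫ t, cauchyOverlap z t := by
  rw [integral_pos_iff_support_of_nonneg (fun t => (cauchyOverlap_pos z t).le)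
    (integrable_cauchyOverlap z)]
  have : Function.support (cauchyOverlap z) = Set.univ :=
    Set.eq_univ_of_forall fun t => (cauchyOverlap_pos z t).ne'
  simp [this]

lemma integral_Ioi_inv_one_add_add_sq (z : ℝ) :
    ∫ t in Set.Ioi (0 : ℝ), (1 + (t + z) ^ 2)⁻¹ = π / 2 - arctan z := by
  have h := (measurePreserving_add_right volume z).setIntegral_preimage_emb
    (measurableEmbedding_addRight z) (fun x : ℝ => (1 + x ^ 2)⁻¹) (Set.Ioi z)
  rw [Set.preimage_add_const_Ioi, sub_self] at h
  rw [h, integral_Ioi_inv_one_add_sq]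

lemma sq_integral_cauchyOverlap_le (z : ℝ) :
    (∫ t, cauchyOverlap z t) ^ 2 ≤ π ^ 2 - (2 * arctan z) ^ 2 := by
  have hu : 0 < π / 2 + arctan z := by linarith [neg_pi_div_two_lt_arctan z]
  have hv : 0 < π / 2 - arctan z := by linarith [arctan_lt_pi_div_two z]
  set a := √(π / 2 + arctan z)
  set b := √(π / 2 - arctan z)
  have ha0 : 0 < a := sqrt_pos.2 hu
  have hb0 : 0 < b := sqrt_pos.2 hv
  have ha2 : a ^ 2 = π / 2 + arctan z := sq_sqrt hu.le
  have hb2 : b ^ 2 = π / 2 - arctan z := sq_sqrt hv.le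
  have hsub : ∫ t in Set.Ioi (0 : ℝ), (1 + (t - z) ^ 2)⁻¹ = a ^ 2 := by
    simpa [ha2, sub_eq_add_neg] using integral_Ioi_inv_one_add_add_sq (-z)
  have hadd : ∫ t in Set.Ioi (0 : ℝ), (1 + (t + z) ^ 2)⁻¹ = b ^ 2 := by
    rw [integral_Ioi_inv_one_add_add_sq, hb2]
  have hi₁ := ((integrable_inv_one_add_sub_sq z).const_mul (b / a)).integrableOn
    (s := Set.Ioi (0 : ℝ))
  have hi₂ := ((integrable_inv_one_add_add_sq z).const_mul (b / a)⁻¹).integrableOn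
    (s := Set.Ioi (0 : ℝ))
  have hle : ∫ t, cauchyOverlap z t ≤ 2 * (a * b) := by
    calc ∫ t, cauchyOverlap z t = ∫ t, cauchyOverlap z |t| := by simp only [cauchyOverlap_abs]
      _ = 2 * ∫ t in Set.Ioi (0 : ℝ), cauchyOverlap z t := integral_comp_abs
      _ ≤ 2 * ∫ t in Set.Ioi (0 : ℝ),
          ((b / a) * (1 + (t - z) ^ 2)⁻¹ + (b / a)⁻¹ * (1 + (t + z) ^ 2)⁻¹) / 2 := by
        gcongr
        · exact (integrable_cauchyOverlap z).integrableOn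
        · exact (hi₁.add hi₂).div_const 2
        · exact measurableSet_Ioi.nullMeasurableSet
        · exact cauchyOverlap_le z _ (div_pos hb0 ha0)
      _ = 2 * (a * b) := by
        rw [integral_div, integral_add hi₁ hi₂, integral_const_mul, integral_const_mul, hsub, hadd]
        field_simp
        ring
  calc (∫ t, cauchyOverlap z t) ^ 2 ≤ (2 * (a * b)) ^ 2 :=
        pow_le_pow_left₀ (integral_cauchyOverlap_pos z).le hle 2
    _ = 4 * (a ^ 2 * b ^ 2) := by ring
    _ = π ^ 2 - (2 * arctan z) ^ 2 := by rw [ha2, hb2]; ring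

lemma integral_sqrt_cauchyMeasure (δ h : ℝ) {γ : ℝ} (hγ : 0 < γ) :
    ∫ x, √(((x - δ) ^ 2 + γ ^ 2) / ((x - δ - h) ^ 2 + γ ^ 2)) ∂(cauchyMeasure δ γ) =
      π⁻¹ * ∫ t, cauchyOverlap (h / γ / 2) t := by
  have hm : Measurable fun x : ℝ => ENNReal.ofReal (γ / (π * ((x - δ) ^ 2 + γ ^ 2))) := by
    fun_prop
  rw [cauchyMeasure, integral_withDensity_eq_integral_toReal_smul hm
    (.of_forall fun _ => ENNReal.ofReal_lt_top)]
  set g : ℝ → ℝ := fun x => (ENNReal.ofReal (γ / (π * ((x - δ) ^ 2 + γ ^ 2)))).toReal •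
    √(((x - δ) ^ 2 + γ ^ 2) / ((x - δ - h) ^ 2 + γ ^ 2)) with hg
  have key : ∀ t, g (γ * t + (δ + h / 2)) = γ⁻¹ * π⁻¹ * cauchyOverlap (h / γ / 2) t := by
    intro t
    have hA : (γ * t + (δ + h / 2) - δ) ^ 2 + γ ^ 2 = γ ^ 2 * (1 + (t + h / γ / 2) ^ 2) := by
      field_simp
      ring
    have hB : (γ * t + (δ + h / 2) - δ - h) ^ 2 + γ ^ 2 =
        γ ^ 2 * (1 + (t - h / γ / 2) ^ 2) := by
      field_simp
      ring
    simp only [hg, hA, hB, cauchyOverlap]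
    rw [ENNReal.toReal_ofReal (by positivity), smul_eq_mul,
      mul_div_mul_left _ _ (by positivity), sqrt_div (by positivity), sqrt_inv, sqrt_inv]
    have hp : √(1 + (t + h / γ / 2) ^ 2) ^ 2 = 1 + (t + h / γ / 2) ^ 2 := sq_sqrt (by positivity)
    have hp0 : 0 < √(1 + (t + h / γ / 2) ^ 2) := by positivity
    have hq0 : 0 < √(1 + (t - h / γ / 2) ^ 2) := by positivity
    generalize √(1 + (t - h / γ / 2) ^ 2) = q at *
    generalize √(1 + (t + h / γ / 2) ^ 2) = p at *
    rw [← hp]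
    field_simp
  have hscale := Measure.integral_comp_mul_left (fun y => g (y + (δ + h / 2))) γ
  rw [integral_add_right_eq_self g] at hscale
  simp only [key, integral_const_mul, abs_of_pos (inv_pos.2 hγ), smul_eq_mul] at hscale
  rw [mul_assoc] at hscale
  exact (mul_left_cancel₀ (inv_pos.2 hγ).ne' hscale).symm

theorem kakutani_series_summable_implies_zeta_tendsto_zero
    (δ h γ : ℕ → ℝ) (hγ : ∀ n, 0 < γ n)
    (H : ℕ → ℝ)
    (hH : ∀ n, H n = ∫ x,
      Real.sqrt (((x - δ n) ^ 2 + γ n ^ 2) / ((x - δ n - h n) ^ 2 + γ n ^ 2))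
        ∂(cauchyMeasure (δ n) (γ n)))
    (hsum : Summable fun n => -Real.log (H n)) :
    Tendsto (fun n => h n / γ n) atTop (nhds 0) := by
  have hH' n : H n = π⁻¹ * ∫ t, cauchyOverlap (h n / γ n / 2) t :=
    (hH n).trans (integral_sqrt_cauchyMeasure _ _ (hγ n))
  have hpos n : 0 < H n := by
    rw [hH']
    exact mul_pos (inv_pos.2 pi_pos) (integral_cauchyOverlap_pos _)
  have hlim : Tendsto H atTop (nhds 1) := by
    simpa [exp_log (hpos _)] using hsum.tendsto_atTop_zero.neg.rexp
  have hbound n : arctan (h n / γ n / 2) ^ 2 ≤ (π / 2) ^ 2 * (1 - H n ^ 2) := by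
    have h₁ := sq_integral_cauchyOverlap_le (h n / γ n / 2)
    have h₂ : ∫ t, cauchyOverlap (h n / γ n / 2) t = π * H n := by
      rw [hH', mul_inv_cancel_left₀ pi_ne_zero]
    rw [h₂] at h₁
    linarith
  have hsq : Tendsto (fun n => arctan (h n / γ n / 2) ^ 2) atTop (nhds 0) := by
    refine squeeze_zero (fun n => sq_nonneg _) hbound ?_
    simpa using ((hlim.pow 2).const_sub 1).const_mul ((π / 2) ^ 2)
  have harctan : Tendsto (fun n => arctan (h n / γ n / 2)) atTop (nhds 0) := by
    rw [tendsto_zero_iff_abs_tendsto_zero]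
    simpa [Function.comp_def, sqrt_sq_eq_abs] using hsq.sqrt
  have htan : Tendsto tan (nhds 0) (nhds 0) := by
    simpa using ((continuousAt_tan (x := 0)).2 (by simp)).tendsto
  have hhalf := (htan.comp harctan).mul_const 2
  simpa [Function.comp_def, tan_arctan] using hhalf
end

section
/- For every s > 0, I(s) ≤ s^{−1/2}, with equality if and only if s = 1; in particular I(1) = 1 and I(s) < s^{−1/2} for every s > 0 with s ≠ 1. -/
open MeasureTheory Real

/-- The function `I(s) = (1/π) ∫_ℝ dy / (√(y² + 1) √(y² + s²))`. -/
noncomputable def cauchyI (s : ℝ) : ℝ :=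
  (1 / π) * ∫ y : ℝ, 1 / (Real.sqrt (y ^ 2 + 1) * Real.sqrt (y ^ 2 + s ^ 2))

lemma inv_sq_add_sq_eq {s : ℝ} (hs : 0 < s) (y : ℝ) :
    (y ^ 2 + s ^ 2)⁻¹ = (s ^ 2)⁻¹ * (1 + (s⁻¹ * y) ^ 2)⁻¹ := by
  have h : 0 < s ^ 2 + y ^ 2 := by positivity
  have h' : y ^ 2 + s ^ 2 = s ^ 2 * (1 + (s⁻¹ * y) ^ 2) := by
    field_simp
    ring
  rw [h', mul_inv]

lemma integrable_inv_sq_add_sq {s : ℝ} (hs : 0 < s) :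
    Integrable fun y : ℝ => (y ^ 2 + s ^ 2)⁻¹ := by
  simp only [inv_sq_add_sq_eq hs]
  exact (integrable_inv_one_add_sq.comp_mul_left' (inv_ne_zero hs.ne')).const_mul _

lemma integral_univ_inv_sq_add_sq {s : ℝ} (hs : 0 < s) :
    ∫ y : ℝ, (y ^ 2 + s ^ 2)⁻¹ = π / s := by
  simp only [inv_sq_add_sq_eq hs]
  rw [integral_const_mul,
    Measure.integral_comp_inv_mul_left (fun x : ℝ => (1 + x ^ 2)⁻¹) s,
    integral_univ_inv_one_add_sq, abs_of_pos hs, smul_eq_mul]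
  field_simp

lemma cauchyI_one : cauchyI 1 = 1 := by
  have h (y : ℝ) : 1 / (√(y ^ 2 + 1) * √(y ^ 2 + 1 ^ 2)) = (y ^ 2 + 1 ^ 2)⁻¹ := by
    rw [one_pow, Real.mul_self_sqrt (by positivity), one_div]
  simp only [cauchyI, h]
  rw [integral_univ_inv_sq_add_sq one_pos]
  field_simp

lemma continuous_one_div_sqrt_mul_sqrt {s : ℝ} (hs : 0 < s) :
    Continuous fun y : ℝ => 1 / (√(y ^ 2 + 1) * √(y ^ 2 + s ^ 2)) := by
  refine continuous_const.div (by fun_prop) fun y => ?_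
  have : 0 < √(y ^ 2 + 1) * √(y ^ 2 + s ^ 2) := by positivity
  exact this.ne'

/-- The deficit in the arithmetic-geometric mean inequality for `t⁻¹ / a²` and `t / b²`. -/
lemma amgm_deficit {t a b : ℝ} (ht : 0 < t) (ha : 0 < a) (hb : 0 < b) :
    2⁻¹ * (t⁻¹ * (a ^ 2)⁻¹ + t * (b ^ 2)⁻¹) - 1 / (a * b)
      = (b - t * a) ^ 2 / (2 * t * a ^ 2 * b ^ 2) := by
  field_simp
  ring

lemma cauchyI_lt_inv_sqrt {s : ℝ} (hs : 0 < s) (hs1 : s ≠ 1) : cauchyI s < (√s)⁻¹ := by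
  set t := √s
  have ht : 0 < t := Real.sqrt_pos.2 hs
  have hts : t ^ 2 = s := Real.sq_sqrt hs.le
  set f : ℝ → ℝ := fun y => 1 / (√(y ^ 2 + 1) * √(y ^ 2 + s ^ 2)) with hf
  set g : ℝ → ℝ := fun y => 2⁻¹ * (t⁻¹ * (y ^ 2 + 1 ^ 2)⁻¹ + t * (y ^ 2 + s ^ 2)⁻¹) with hg
  have hdef (y : ℝ) : g y - f y = (√(y ^ 2 + s ^ 2) - t * √(y ^ 2 + 1)) ^ 2 /
      (2 * t * √(y ^ 2 + 1) ^ 2 * √(y ^ 2 + s ^ 2) ^ 2) := by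
    rw [← amgm_deficit ht (by positivity) (by positivity),
      Real.sq_sqrt (by positivity), Real.sq_sqrt (by positivity)]
    simp only [hg, hf, one_pow]
  have hnonneg (y : ℝ) : 0 ≤ g y - f y := by
    rw [hdef]
    positivity
  have hfc : Continuous f := continuous_one_div_sqrt_mul_sqrt hs
  have hgc : Continuous g := by
    have h1 : Continuous fun y : ℝ => (y ^ 2 + 1 ^ 2)⁻¹ :=
      Continuous.inv₀ (by fun_prop) fun y => by positivity
    have h2 : Continuous fun y : ℝ => (y ^ 2 + s ^ 2)⁻¹ :=
      Continuous.inv₀ (by fun_prop) fun y => by positivity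
    exact ((h1.const_mul _).add (h2.const_mul _)).const_mul _
  have hi1 := (integrable_inv_sq_add_sq one_pos).const_mul t⁻¹
  have hi2 := (integrable_inv_sq_add_sq hs).const_mul t
  have hgi : Integrable g := (hi1.add hi2).const_mul _
  have hfi : Integrable f := by
    refine hgi.mono' hfc.aestronglyMeasurable (ae_of_all _ fun y => ?_)
    have : 0 ≤ f y := by
      simp only [hf]
      positivity
    rw [Real.norm_of_nonneg this]
    linarith [hnonneg y]
  have hne : g 0 - f 0 ≠ 0 := by
    have h : √((0 : ℝ) ^ 2 + s ^ 2) - t * √((0 : ℝ) ^ 2 + 1) = t * (t - 1) := by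
      simp only [ne_eq, OfNat.ofNat_ne_zero, not_false_eq_true, zero_pow, zero_add,
        Real.sqrt_sq hs.le, Real.sqrt_one]
      rw [← hts]
      ring
    have ht1 : t - 1 ≠ 0 := fun h0 => hs1 (by rw [← hts, sub_eq_zero.1 h0, one_pow])
    rw [hdef, h]
    positivity
  have hpos : 0 < ∫ y, (g y - f y) :=
    integral_pos_of_integrable_nonneg_nonzero (hgc.sub hfc) (hgi.sub hfi) hnonneg hne
  have hgint : ∫ y, g y = π * t⁻¹ := by
    simp only [hg]
    rw [integral_const_mul, integral_add hi1 hi2, integral_const_mul, integral_const_mul,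
      integral_univ_inv_sq_add_sq one_pos, integral_univ_inv_sq_add_sq hs, ← hts]
    field_simp
    ring
  rw [integral_sub hgi hfi, hgint, sub_pos] at hpos
  change 1 / π * ∫ y, f y < t⁻¹
  rw [one_div, inv_mul_lt_iff₀ Real.pi_pos]
  exact hpos

theorem cauchyI_le_inv_sqrt :
    (∀ s : ℝ, 0 < s → cauchyI s ≤ (Real.sqrt s)⁻¹) ∧
    (∀ s : ℝ, 0 < s → (cauchyI s = (Real.sqrt s)⁻¹ ↔ s = 1)) ∧
    cauchyI 1 = 1 ∧
    (∀ s : ℝ, 0 < s → s ≠ 1 → cauchyI s < (Real.sqrt s)⁻¹) := by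
  have h1 : cauchyI 1 = (√1)⁻¹ := by rw [cauchyI_one, Real.sqrt_one, inv_one]
  refine ⟨fun s hs => ?_, fun s hs => ⟨fun h => ?_, ?_⟩, cauchyI_one,
    fun s hs hs1 => cauchyI_lt_inv_sqrt hs hs1⟩
  · rcases eq_or_ne s 1 with rfl | hs1
    · exact h1.le
    · exact (cauchyI_lt_inv_sqrt hs hs1).le
  · by_contra hs1
    exact (cauchyI_lt_inv_sqrt hs hs1).ne h
  · rintro rfl
    exact h1
end

section
/- The function I is infinitely differentiable at s = 1, and the sequence (a_ℓ)_{ℓ∈ℕ} of its Taylor coefficients at 1, defined by a_ℓ = I^{(ℓ)}(1)/ℓ!, is bounded: there exists C > 0 such that |a_ℓ| ≤ C for all ℓ ∈ ℕ. -/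
open MeasureTheory Real

open Finset.HasAntidiagonal (antidiagonal mem_antidiagonal)

/-- The Taylor coefficients at `0` of `z ↦ (1 - z) ^ (-1 / 2)`. -/
noncomputable def invSqrtCoeff (n : ℕ) : ℝ := n.centralBinom / 4 ^ n

theorem invSqrtCoeff_nonneg (n : ℕ) : 0 ≤ invSqrtCoeff n := by
  unfold invSqrtCoeff; positivity

theorem invSqrtCoeff_le_one (n : ℕ) : invSqrtCoeff n ≤ 1 := by
  unfold invSqrtCoeff
  rw [div_le_one (by positivity)]
  exact_mod_cast Nat.centralBinom_le_four_pow n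

theorem succ_mul_invSqrtCoeff_succ (n : ℕ) :
    ((n : ℝ) + 1) * invSqrtCoeff (n + 1) = (n + 1 / 2) * invSqrtCoeff n := by
  have h : ((n : ℝ) + 1) * (n + 1).centralBinom = 2 * (2 * n + 1) * n.centralBinom := by
    exact_mod_cast Nat.succ_mul_centralBinom_succ n
  unfold invSqrtCoeff
  rw [← mul_div_assoc, h]
  field_simp
  ring

/-- The square of the power series of `(1 - z) ^ (-1 / 2)` is the geometric series. -/
theorem sum_antidiagonal_invSqrtCoeff (n : ℕ) :
    ∑ p ∈ antidiagonal n, invSqrtCoeff p.1 * invSqrtCoeff p.2 = 1 := by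
  have sum_symm (m : ℕ) : (m : ℝ) * ∑ p ∈ antidiagonal m, invSqrtCoeff p.1 * invSqrtCoeff p.2 =
      2 * ∑ p ∈ antidiagonal m, (p.1 : ℝ) * (invSqrtCoeff p.1 * invSqrtCoeff p.2) := by
    have hswap : ∑ p ∈ antidiagonal m, (p.1 : ℝ) * (invSqrtCoeff p.1 * invSqrtCoeff p.2) =
        ∑ p ∈ antidiagonal m, (p.2 : ℝ) * (invSqrtCoeff p.1 * invSqrtCoeff p.2) := by
      rw [← Finset.Nat.sum_antidiagonal_swap]
      exact Finset.sum_congr rfl fun p _ ↦ by simp [mul_comm]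
    rw [two_mul]
    nth_rewrite 2 [hswap]
    rw [← Finset.sum_add_distrib, Finset.mul_sum]
    refine Finset.sum_congr rfl fun p hp ↦ ?_
    rw [← mem_antidiagonal.mp hp]
    push_cast
    ring
  induction n with
  | zero => simp [invSqrtCoeff]
  | succ n ih =>
    have h := sum_symm (n + 1)
    rw [Finset.Nat.sum_antidiagonal_succ (f := fun p ↦
      (p.1 : ℝ) * (invSqrtCoeff p.1 * invSqrtCoeff p.2))] at h
    have hterm (p : ℕ × ℕ) : ((p.1 + 1 : ℕ) : ℝ) * (invSqrtCoeff (p.1 + 1) * invSqrtCoeff p.2) =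
        (p.1 : ℝ) * (invSqrtCoeff p.1 * invSqrtCoeff p.2) +
          1 / 2 * (invSqrtCoeff p.1 * invSqrtCoeff p.2) := by
      push_cast
      rw [← mul_assoc, succ_mul_invSqrtCoeff_succ]
      ring
    simp only [hterm, Finset.sum_add_distrib, ← Finset.mul_sum] at h
    have h' := sum_symm n
    rw [ih] at h h'
    have hn : ((n + 1 : ℕ) : ℝ) ≠ 0 := by positivity
    refine mul_left_cancel₀ hn (h.trans ?_)
    push_cast at h' ⊢
    linarith

theorem summable_norm_invSqrtCoeff_mul_pow {u : ℂ} (hu : ‖u‖ < 1) :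
    Summable fun n ↦ ‖(invSqrtCoeff n : ℂ) * u ^ n‖ := by
  refine (summable_geometric_of_lt_one (norm_nonneg u) hu).of_nonneg_of_le
    (fun n ↦ norm_nonneg _) fun n ↦ ?_
  rw [norm_mul, norm_pow, Complex.norm_real, norm_of_nonneg (invSqrtCoeff_nonneg n)]
  exact mul_le_of_le_one_left (by positivity) (invSqrtCoeff_le_one n)

theorem sq_tsum_invSqrtCoeff_mul_pow {u : ℂ} (hu : ‖u‖ < 1) :
    (∑' n, (invSqrtCoeff n : ℂ) * u ^ n) ^ 2 = (1 - u)⁻¹ := by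
  have h := summable_norm_invSqrtCoeff_mul_pow hu
  rw [sq, tsum_mul_tsum_eq_tsum_sum_antidiagonal_of_summable_norm h h,
    ← tsum_geometric_of_norm_lt_one hu]
  refine tsum_congr fun n ↦ ?_
  calc _ = ∑ p ∈ antidiagonal n, ((invSqrtCoeff p.1 * invSqrtCoeff p.2 : ℝ) : ℂ) * u ^ n := by
        refine Finset.sum_congr rfl fun p hp ↦ ?_
        rw [← mem_antidiagonal.mp hp, pow_add]
        push_cast
        ring
    _ = u ^ n := by
        rw [← Finset.sum_mul, ← Complex.ofReal_sum, sum_antidiagonal_invSqrtCoeff]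
        simp

/-- The homogeneous components of the expansion of `u ↦ ‖1 - u‖⁻¹` in powers of `u` and its
conjugate. -/
noncomputable def invNormCoeff (n : ℕ) (u : ℂ) : ℝ :=
  (∑ p ∈ antidiagonal n,
    (invSqrtCoeff p.1 * u ^ p.1) * (invSqrtCoeff p.2 * (starRingEnd ℂ u) ^ p.2)).re

theorem continuous_invNormCoeff (n : ℕ) : Continuous (invNormCoeff n) := by
  unfold invNormCoeff
  fun_prop

theorem abs_invNormCoeff_le (n : ℕ) (u : ℂ) : |invNormCoeff n u| ≤ ‖u‖ ^ n := by
  refine (Complex.abs_re_le_norm _).trans ((norm_sum_le _ _).trans_eq ?_)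
  calc _ = ∑ p ∈ antidiagonal n, invSqrtCoeff p.1 * invSqrtCoeff p.2 * ‖u‖ ^ n := by
        refine Finset.sum_congr rfl fun p hp ↦ ?_
        simp only [norm_mul, norm_pow, Complex.norm_real, RCLike.norm_conj,
          norm_of_nonneg (invSqrtCoeff_nonneg _)]
        rw [← mem_antidiagonal.mp hp, pow_add]
        ring
    _ = ‖u‖ ^ n := by rw [← Finset.sum_mul, sum_antidiagonal_invSqrtCoeff, one_mul]

theorem invNormCoeff_real_mul (n : ℕ) (t : ℝ) (u : ℂ) :
    invNormCoeff n (t * u) = t ^ n * invNormCoeff n u := by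
  unfold invNormCoeff
  rw [← Complex.re_ofReal_mul, Finset.mul_sum]
  congr 1
  refine Finset.sum_congr rfl fun p hp ↦ ?_
  rw [← mem_antidiagonal.mp hp, map_mul, Complex.conj_ofReal]
  push_cast
  ring

theorem hasSum_invNormCoeff {u : ℂ} (hu : ‖u‖ < 1) :
    HasSum (fun n ↦ invNormCoeff n u) ‖1 - u‖⁻¹ := by
  have hu' : ‖starRingEnd ℂ u‖ < 1 := by simpa using hu
  have h := summable_norm_invSqrtCoeff_mul_pow hu
  have h' := summable_norm_invSqrtCoeff_mul_pow hu'
  have hs := (summable_norm_sum_mul_antidiagonal_of_summable_norm h h').of_norm.hasSum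
  rw [← tsum_mul_tsum_eq_tsum_sum_antidiagonal_of_summable_norm h h'] at hs
  have hconj : ∑' n, (invSqrtCoeff n : ℂ) * (starRingEnd ℂ u) ^ n =
      starRingEnd ℂ (∑' n, (invSqrtCoeff n : ℂ) * u ^ n) := by
    rw [Complex.conj_tsum]
    simp
  rw [hconj, Complex.mul_conj, Complex.normSq_eq_norm_sq, ← norm_pow,
    sq_tsum_invSqrtCoeff_mul_pow hu, norm_inv] at hs
  simpa [invNormCoeff] using Complex.hasSum_re hs

/-- The integrand of the `n`-th Taylor coefficient of `cauchyI` at `1`. -/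
noncomputable def cauchyIntegrand (n : ℕ) (y : ℝ) : ℝ :=
  (1 + y ^ 2)⁻¹ * invNormCoeff n (-(1 + y * Complex.I)⁻¹)

theorem norm_one_add_mul_I (s y : ℝ) : ‖(s + y * Complex.I : ℂ)‖ = √(y ^ 2 + s ^ 2) := by
  rw [Complex.norm_add_mul_I, add_comm]

theorem one_add_mul_I_ne_zero (y : ℝ) : (1 + y * Complex.I : ℂ) ≠ 0 := fun h ↦ by
  simpa using congrArg Complex.re h

theorem norm_neg_inv_one_add_mul_I_le (y : ℝ) : ‖-(1 + y * Complex.I : ℂ)⁻¹‖ ≤ 1 := by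
  rw [norm_neg, norm_inv]
  refine inv_le_one_of_one_le₀ ?_
  simpa using Complex.abs_re_le_norm (1 + y * Complex.I : ℂ)

theorem abs_cauchyIntegrand_le (n : ℕ) (y : ℝ) : |cauchyIntegrand n y| ≤ (1 + y ^ 2)⁻¹ := by
  rw [cauchyIntegrand, abs_mul, abs_of_nonneg (by positivity)]
  exact mul_le_of_le_one_right (by positivity) ((abs_invNormCoeff_le _ _).trans
    (pow_le_one₀ (norm_nonneg _) (norm_neg_inv_one_add_mul_I_le y)))

theorem continuous_cauchyIntegrand (n : ℕ) : Continuous (cauchyIntegrand n) := by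
  refine Continuous.mul ?_ ((continuous_invNormCoeff n).comp ?_)
  · exact Continuous.inv₀ (by fun_prop) fun y ↦ by positivity
  · exact (Continuous.inv₀ (by fun_prop) one_add_mul_I_ne_zero).neg

theorem integrable_cauchyIntegrand (n : ℕ) : Integrable (cauchyIntegrand n) :=
  integrable_inv_one_add_sq.mono' (continuous_cauchyIntegrand n).aestronglyMeasurable
    (.of_forall (abs_cauchyIntegrand_le n))

theorem integral_norm_cauchyIntegrand_le (n : ℕ) : ∫ y, ‖cauchyIntegrand n y‖ ≤ π := by
  rw [← integral_univ_inv_one_add_sq]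
  exact integral_mono (integrable_cauchyIntegrand n).norm integrable_inv_one_add_sq
    (abs_cauchyIntegrand_le n)

theorem hasSum_pow_mul_cauchyIntegrand {t : ℝ} (ht : |t| < 1) (y : ℝ) :
    HasSum (fun n ↦ t ^ n * cauchyIntegrand n y)
      (1 / (√(y ^ 2 + 1) * √(y ^ 2 + (1 + t) ^ 2))) := by
  set w : ℂ := -(1 + y * Complex.I)⁻¹ with hw
  have hu : ‖(t * w : ℂ)‖ < 1 := by
    rw [norm_mul, Complex.norm_real]
    exact (mul_le_of_le_one_right (norm_nonneg t) (norm_neg_inv_one_add_mul_I_le y)).trans_lt ht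
  have h := (hasSum_invNormCoeff hu).mul_left (1 + y ^ 2)⁻¹
  simp only [invNormCoeff_real_mul] at h
  have hR : √(y ^ 2 + 1) = ‖(1 + y * Complex.I : ℂ)‖ := by
    simpa using (norm_one_add_mul_I 1 y).symm
  have hS : √(y ^ 2 + (1 + t) ^ 2) = ‖(1 + y * Complex.I : ℂ)‖ * ‖1 - t * w‖ := by
    rw [← norm_one_add_mul_I, ← norm_mul, hw]
    congr 1
    field_simp [one_add_mul_I_ne_zero y]
    push_cast
    ring
  have hsq : 1 + y ^ 2 = ‖(1 + y * Complex.I : ℂ)‖ ^ 2 := by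
    rw [← hR, Real.sq_sqrt (by positivity), add_comm]
  convert! h using 1
  · ext n
    simp only [cauchyIntegrand, ← hw]
    ring
  · rw [hS, hR, hsq]
    simp only [one_div, mul_inv, sq]
    ring

/-- The Taylor coefficients of `cauchyI` at `1`. -/
noncomputable def cauchyICoeff (n : ℕ) : ℝ := (1 / π) * ∫ y, cauchyIntegrand n y

theorem abs_cauchyICoeff_le_one (n : ℕ) : |cauchyICoeff n| ≤ 1 := by
  rw [cauchyICoeff, abs_mul, abs_of_pos (by positivity), one_div,
    inv_mul_le_one₀ pi_pos]
  exact (norm_integral_le_integral_norm _).trans (integral_norm_cauchyIntegrand_le n)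

theorem hasSum_cauchyICoeff {t : ℝ} (ht : |t| < 1) :
    HasSum (fun n ↦ t ^ n * cauchyICoeff n) (cauchyI (1 + t)) := by
  have hsum : Summable fun n ↦ ∫ y, ‖t ^ n * cauchyIntegrand n y‖ := by
    refine ((summable_geometric_of_lt_one (abs_nonneg t) ht).mul_right π).of_nonneg_of_le
      (fun n ↦ integral_nonneg fun y ↦ norm_nonneg _) fun n ↦ ?_
    simp only [norm_mul, norm_pow, integral_const_mul, norm_eq_abs t]
    gcongr
    exact integral_norm_cauchyIntegrand_le n
  have h := (hasSum_integral_of_summable_integral_norm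
    (fun n ↦ (integrable_cauchyIntegrand n).const_mul (t ^ n)) hsum).mul_left (1 / π)
  simp only [(hasSum_pow_mul_cauchyIntegrand ht _).tsum_eq, integral_const_mul] at h
  rw [cauchyI]
  convert! h using 2 with n
  rw [cauchyICoeff]
  ring

theorem hasFPowerSeriesOnBall_cauchyI :
    HasFPowerSeriesOnBall cauchyI (.ofScalars ℝ cauchyICoeff) 1 1 where
  r_le := by
    refine FormalMultilinearSeries.le_radius_of_bound (r := 1) _ 1 fun n ↦ ?_
    simpa using abs_cauchyICoeff_le_one n
  r_pos := one_pos
  hasSum {t} ht := by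
    have ht' : |t| < 1 := by
      rwa [Metric.mem_eball, edist_zero_right, ← ofReal_norm, ENNReal.ofReal_lt_one] at ht
    simpa [mul_comm] using hasSum_cauchyICoeff ht'

theorem iteratedDeriv_cauchyI_one_div_factorial (n : ℕ) :
    iteratedDeriv n cauchyI 1 / n.factorial = cauchyICoeff n := by
  have h := hasFPowerSeriesOnBall_cauchyI.factorial_smul 1 n
  rw [← iteratedDeriv_eq_iteratedFDeriv] at h
  rw [← h, div_eq_iff (by positivity)]
  simp [mul_comm]

theorem cauchyI_taylor_coeff_bounded :
    ContDiffAt ℝ (⊤ : ℕ∞) cauchyI 1 ∧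
    ∃ C : ℝ, 0 < C ∧ ∀ ℓ : ℕ,
      |iteratedDeriv ℓ cauchyI 1 / ℓ.factorial| ≤ C := by
  refine ⟨hasFPowerSeriesOnBall_cauchyI.analyticAt.contDiffAt, 1, one_pos, fun n ↦ ?_⟩
  rw [iteratedDeriv_cauchyI_one_div_factorial]
  exact abs_cauchyICoeff_le_one n
end

section
/- The function I is differentiable to second order at s = 1, with I(1) = 1, I'(1) = −1/2, and I''(1)/2 = 5/16; equivalently, the Taylor coefficients of I at 1 satisfy a_0 = 1, a_1 = −1/2 and a_2 = 5/16. -/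
open MeasureTheory Real

theorem integrable_inv_one_add_sq_pow (m : ℕ) (hm : 1 ≤ m) :
    Integrable fun y : ℝ => ((1 + y ^ 2) ^ m)⁻¹ := by
  refine integrable_inv_one_add_sq.mono' (by fun_prop) (.of_forall fun y => ?_)
  rw [Real.norm_of_nonneg (by positivity)]
  exact inv_anti₀ (by positivity) (le_self_pow₀ (by nlinarith [sq_nonneg y]) (by omega))

open Filter Topology in
/-- Wallis-type recursion for the integrals of powers of `(1 + y ^ 2)⁻¹`. -/
theorem integral_inv_one_add_sq_pow_succ (n : ℕ) (hn : 1 ≤ n) :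
    2 * (n : ℝ) * ∫ y : ℝ, ((1 + y ^ 2) ^ (n + 1))⁻¹ =
      (2 * n - 1) * ∫ y : ℝ, ((1 + y ^ 2) ^ n)⁻¹ := by
  have hderiv : ∀ y : ℝ, HasDerivAt (fun y : ℝ => y / (1 + y ^ 2) ^ n)
      (2 * (n : ℝ) * ((1 + y ^ 2) ^ (n + 1))⁻¹ -
        (2 * (n : ℝ) - 1) * ((1 + y ^ 2) ^ n)⁻¹) y := by
    intro y
    have hpos : 0 < 1 + y ^ 2 := by positivity
    obtain ⟨m, rfl⟩ : ∃ m, n = m + 1 := ⟨n - 1, by omega⟩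
    have h := (hasDerivAt_id y).div
      ((((hasDerivAt_id y).pow 2).const_add 1).pow (m + 1)) (pow_pos hpos _).ne'
    refine h.congr_deriv ?_
    simp only [id, Pi.pow_apply, Nat.add_sub_cancel]
    push_cast
    field_simp
    ring
  have hbound : ∀ y : ℝ, ‖y / (1 + y ^ 2) ^ n‖ ≤ |y|⁻¹ := by
    intro y
    rcases eq_or_ne y 0 with rfl | hy
    · simp
    have hy' : 0 < |y| := abs_pos.mpr hy
    have hone : (1 : ℝ) ≤ 1 + y ^ 2 := by nlinarith [sq_nonneg y]
    have hpow : 1 + y ^ 2 ≤ (1 + y ^ 2) ^ n := le_self_pow₀ hone (by omega)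
    rw [norm_div, Real.norm_eq_abs, Real.norm_eq_abs, abs_of_pos (a := (1 + y ^ 2) ^ n)
      (by positivity), div_le_iff₀ (by positivity), inv_mul_eq_div, le_div_iff₀ hy']
    nlinarith [abs_mul_abs_self y]
  have hlim (l : Filter ℝ) (hl : Tendsto (fun y : ℝ => |y|) l atTop) :
      Tendsto (fun y : ℝ => y / (1 + y ^ 2) ^ n) l (𝓝 0) :=
    squeeze_zero_norm hbound (tendsto_inv_atTop_zero.comp hl)
  have h₁ := (integrable_inv_one_add_sq_pow (n + 1) (by omega)).const_mul (2 * (n : ℝ))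
  have h₂ := (integrable_inv_one_add_sq_pow n hn).const_mul (2 * (n : ℝ) - 1)
  have h := integral_of_hasDerivAt_of_tendsto hderiv (h₁.sub h₂)
    (hlim atBot tendsto_abs_atBot_atTop) (hlim atTop tendsto_abs_atTop_atTop)
  rw [integral_sub h₁ h₂, integral_const_mul, integral_const_mul] at h
  linarith

/-- The integrand of `cauchyI` with the factor `√(y ^ 2 + s ^ 2)` raised to the power `2 k + 1`. -/
noncomputable def cauchyKernel (k : ℕ) (s y : ℝ) : ℝ :=
  1 / (√(y ^ 2 + 1) * √(y ^ 2 + s ^ 2) ^ (2 * k + 1))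

theorem cauchyKernel_one (k : ℕ) (y : ℝ) : cauchyKernel k 1 y = ((1 + y ^ 2) ^ (k + 1))⁻¹ := by
  rw [cauchyKernel, one_pow, ← pow_succ', show 2 * k + 1 + 1 = 2 * (k + 1) by ring, pow_mul,
    Real.sq_sqrt (by positivity), one_div, add_comm (y ^ 2)]

theorem continuous_cauchyKernel (k : ℕ) {s : ℝ} (hs : 0 < s) : Continuous (cauchyKernel k s) := by
  unfold cauchyKernel
  refine continuous_const.div (by fun_prop) fun y => ?_
  positivity

theorem mul_sqrt_le_sqrt {c s : ℝ} (hc : 0 ≤ c) (hc1 : c ≤ 1) (hcs : c ≤ s) (y : ℝ) :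
    c * √(y ^ 2 + 1) ≤ √(y ^ 2 + s ^ 2) := by
  refine Real.le_sqrt_of_sq_le ?_
  rw [mul_pow, Real.sq_sqrt (by positivity)]
  nlinarith [mul_nonneg (sq_nonneg y) (by nlinarith : 0 ≤ 1 - c ^ 2)]

theorem cauchyKernel_le (k : ℕ) {c s : ℝ} (hc : 0 < c) (hc1 : c ≤ 1) (hcs : c ≤ s) (y : ℝ) :
    cauchyKernel k s y ≤ (c ^ (2 * k + 1))⁻¹ * (1 + y ^ 2)⁻¹ := by
  have hpow : (c * √(y ^ 2 + 1)) ^ (2 * k + 1) ≤ √(y ^ 2 + s ^ 2) ^ (2 * k + 1) :=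
    pow_le_pow_left₀ (by positivity) (mul_sqrt_le_sqrt hc.le hc1 hcs y) _
  have hone : 1 ≤ √(y ^ 2 + 1) := Real.one_le_sqrt.mpr (by nlinarith [sq_nonneg y])
  have hself : √(y ^ 2 + 1) ≤ √(y ^ 2 + 1) ^ (2 * k + 1) := le_self_pow₀ hone (by omega)
  rw [cauchyKernel, one_div, ← mul_inv]
  refine inv_anti₀ (by positivity) ?_
  calc c ^ (2 * k + 1) * (1 + y ^ 2)
      = √(y ^ 2 + 1) * (c ^ (2 * k + 1) * √(y ^ 2 + 1)) := by
        linear_combination (-c ^ (2 * k + 1)) * Real.mul_self_sqrt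
          (show (0 : ℝ) ≤ y ^ 2 + 1 by positivity)
    _ ≤ √(y ^ 2 + 1) * (c ^ (2 * k + 1) * √(y ^ 2 + 1) ^ (2 * k + 1)) := by gcongr
    _ ≤ √(y ^ 2 + 1) * √(y ^ 2 + s ^ 2) ^ (2 * k + 1) := by
        rw [← mul_pow]; gcongr

theorem mul_cauchyKernel_succ_le (k : ℕ) {c s : ℝ} (hc : 0 < c) (hcs : c ≤ s) (y : ℝ) :
    s * cauchyKernel (k + 1) s y ≤ c⁻¹ * cauchyKernel k s y := by
  have hs : 0 < s := hc.trans_le hcs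
  have hle : s ≤ √(y ^ 2 + s ^ 2) := Real.le_sqrt_of_sq_le (by nlinarith [sq_nonneg y])
  have hR : 0 < √(y ^ 2 + s ^ 2) := hs.trans_le hle
  have hmul : c * s ≤ √(y ^ 2 + s ^ 2) * √(y ^ 2 + s ^ 2) :=
    mul_le_mul (hcs.trans hle) hle hs.le hR.le
  have hsucc : cauchyKernel (k + 1) s y =
      cauchyKernel k s y / (√(y ^ 2 + s ^ 2) * √(y ^ 2 + s ^ 2)) := by
    unfold cauchyKernel
    field_simp
    ring
  have hnonneg : 0 ≤ cauchyKernel k s y := by unfold cauchyKernel; positivity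
  rw [hsucc, ← mul_div_assoc, div_le_iff₀ (by positivity)]
  calc s * cauchyKernel k s y = c⁻¹ * cauchyKernel k s y * (c * s) := by field_simp
    _ ≤ _ := by gcongr

theorem integrable_cauchyKernel (k : ℕ) {s : ℝ} (hs : 0 < s) : Integrable (cauchyKernel k s) := by
  refine (integrable_inv_one_add_sq.const_mul (((min 1 s) ^ (2 * k + 1))⁻¹)).mono'
    (continuous_cauchyKernel k hs).aestronglyMeasurable (.of_forall fun y => ?_)
  rw [Real.norm_of_nonneg (by unfold cauchyKernel; positivity)]
  exact cauchyKernel_le k (lt_min one_pos hs) (min_le_left _ _) (min_le_right _ _) y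

theorem hasDerivAt_cauchyKernel (k : ℕ) {s : ℝ} (hs : 0 < s) (y : ℝ) :
    HasDerivAt (fun s => cauchyKernel k s y)
      (-(2 * k + 1) * (s * cauchyKernel (k + 1) s y)) s := by
  have hpos : 0 < y ^ 2 + s ^ 2 := by positivity
  have hR : 0 < √(y ^ 2 + s ^ 2) := Real.sqrt_pos.mpr hpos
  have hS : 0 < √(y ^ 2 + 1) := Real.sqrt_pos.mpr (by positivity)
  have hroot := (((hasDerivAt_pow 2 s).const_add (y ^ 2)).sqrt hpos.ne').pow (2 * k + 1)
  have h := (hroot.const_mul √(y ^ 2 + 1)).inv (mul_pos hS (pow_pos hR _)).ne'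
  have heq : (fun s => cauchyKernel k s y) =
      (fun s => √(y ^ 2 + 1) * √(y ^ 2 + s ^ 2) ^ (2 * k + 1))⁻¹ := by
    ext t
    simp [cauchyKernel]
  rw [heq]
  refine h.congr_deriv ?_
  simp only [cauchyKernel, Pi.pow_apply, Nat.add_sub_cancel]
  push_cast
  field_simp
  ring

/-- The integral of `cauchyKernel k s`; up to the factor `π⁻¹`, `k = 0` is `cauchyI`. -/
noncomputable def cauchyIntegral (k : ℕ) (s : ℝ) : ℝ := ∫ y : ℝ, cauchyKernel k s y

theorem hasDerivAt_cauchyIntegral (k : ℕ) {s : ℝ} (hs : 0 < s) :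
    HasDerivAt (cauchyIntegral k) (-(2 * k + 1) * (s * cauchyIntegral (k + 1) s)) s := by
  obtain ⟨c, hc, hcs⟩ : ∃ c, 0 < c ∧ c < min 1 s := exists_between (lt_min one_pos hs)
  have hc1 : c ≤ 1 := (hcs.trans_le (min_le_left _ _)).le
  have hmem : Set.Ioi c ∈ nhds s := Ioi_mem_nhds (hcs.trans_le (min_le_right _ _))
  have h := (hasDerivAt_integral_of_dominated_loc_of_deriv_le (μ := volume)
    (F := cauchyKernel k)
    (F' := fun s y => -(2 * k + 1) * (s * cauchyKernel (k + 1) s y))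
    (bound := fun y => (2 * k + 1) * (c⁻¹ * ((c ^ (2 * k + 1))⁻¹ * (1 + y ^ 2)⁻¹))) hmem
    ?_ (integrable_cauchyKernel k hs) ?_ ?_ ?_ ?_).2
  · rwa [integral_const_mul, integral_const_mul] at h
  · filter_upwards [hmem] with t ht
    exact (continuous_cauchyKernel k (hc.trans ht)).aestronglyMeasurable
  · exact ((continuous_cauchyKernel (k + 1) hs).const_mul s |>.const_mul _).aestronglyMeasurable
  · refine .of_forall fun y t ht => ?_
    have ht' : 0 < t := hc.trans ht
    have hnonneg : 0 ≤ cauchyKernel (k + 1) t y := by unfold cauchyKernel; positivity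
    rw [neg_mul, norm_neg, Real.norm_of_nonneg (by positivity)]
    refine mul_le_mul_of_nonneg_left ?_ (by positivity)
    refine (mul_cauchyKernel_succ_le k hc (le_of_lt ht) y).trans ?_
    gcongr
    exact cauchyKernel_le k hc hc1 (le_of_lt ht) y
  · exact ((integrable_inv_one_add_sq.const_mul _).const_mul _).const_mul _
  · exact .of_forall fun y t ht => hasDerivAt_cauchyKernel k (hc.trans ht) y

theorem contDiffOn_cauchyIntegral (n : ℕ) :
    ∀ k : ℕ, ContDiffOn ℝ n (cauchyIntegral k) (Set.Ioi 0) := by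
  induction n with
  | zero =>
    intro k
    exact contDiffOn_zero.mpr fun s hs =>
      (hasDerivAt_cauchyIntegral k hs).continuousAt.continuousWithinAt
  | succ n ih =>
    intro k
    push_cast
    refine (contDiffOn_succ_iff_deriv_of_isOpen isOpen_Ioi).mpr ⟨fun s hs =>
      (hasDerivAt_cauchyIntegral k hs).differentiableAt.differentiableWithinAt, by simp, ?_⟩
    refine ContDiffOn.congr ?_ fun s hs => (hasDerivAt_cauchyIntegral k hs).deriv
    exact contDiffOn_const.mul (contDiffOn_id.mul (ih (k + 1)))

theorem cauchyI_eq (s : ℝ) : cauchyI s = 1 / π * cauchyIntegral 0 s := by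
  simp [cauchyI, cauchyIntegral, cauchyKernel]

theorem cauchyIntegral_zero_one : cauchyIntegral 0 1 = π := by
  simp [cauchyIntegral, cauchyKernel_one]

theorem cauchyIntegral_succ_one (k : ℕ) :
    2 * ((k : ℝ) + 1) * cauchyIntegral (k + 1) 1 = (2 * k + 1) * cauchyIntegral k 1 := by
  have h := integral_inv_one_add_sq_pow_succ (k + 1) (by omega)
  simp only [cauchyIntegral, cauchyKernel_one]
  push_cast at h
  linear_combination h

theorem hasDerivAt_cauchyI {s : ℝ} (hs : 0 < s) :
    HasDerivAt cauchyI (-(1 / π) * (s * cauchyIntegral 1 s)) s := by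
  rw [funext cauchyI_eq]
  refine ((hasDerivAt_cauchyIntegral 0 hs).const_mul (1 / π)).congr_deriv ?_
  push_cast
  ring

theorem hasDerivAt_deriv_cauchyI {s : ℝ} (hs : 0 < s) :
    HasDerivAt (deriv cauchyI)
      (-(1 / π) * (cauchyIntegral 1 s - 3 * s ^ 2 * cauchyIntegral 2 s)) s := by
  have h := ((hasDerivAt_id s).mul (hasDerivAt_cauchyIntegral 1 hs)).const_mul (-(1 / π))
  refine HasDerivAt.congr_of_eventuallyEq (h.congr_deriv ?_) ?_
  · push_cast
    simp only [id]
    ring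
  · filter_upwards [Ioi_mem_nhds hs] with t ht
    simpa using (hasDerivAt_cauchyI ht).deriv

theorem cauchyI_taylor_coefficients :
    ContDiffAt ℝ 2 cauchyI 1 ∧
    cauchyI 1 = 1 ∧
    deriv cauchyI 1 = -(1 / 2) ∧
    iteratedDeriv 2 cauchyI 1 / 2 = 5 / 16 := by
  have hπ : π ≠ 0 := Real.pi_ne_zero
  have h₁ : cauchyIntegral 1 1 = π / 2 := by
    have h := cauchyIntegral_succ_one 0
    rw [cauchyIntegral_zero_one] at h
    norm_num at h
    linarith
  have h₂ : cauchyIntegral 2 1 = 3 * π / 8 := by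
    have h := cauchyIntegral_succ_one 1
    rw [h₁] at h
    norm_num at h
    linarith
  refine ⟨?_, ?_, ?_, ?_⟩
  · rw [funext cauchyI_eq]
    exact contDiffAt_const.mul
      ((contDiffOn_cauchyIntegral 2 0).contDiffAt (Ioi_mem_nhds one_pos))
  · rw [cauchyI_eq, cauchyIntegral_zero_one]
    field_simp
  · rw [(hasDerivAt_cauchyI one_pos).deriv, h₁]
    field_simp
  · rw [iteratedDeriv_succ, iteratedDeriv_one, (hasDerivAt_deriv_cauchyI one_pos).deriv, h₁, h₂]
    field_simp
    norm_num
end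

section
/- There exist α ∈ (0,1) and C > 0 such that for every s > 0 with 0 < |s − 1| < α, writing τ = s − 1, the series ε(s) = ∑_{ℓ=2}^∞ a_ℓ τ^{ℓ−1} converges absolutely, I(s) = 1 + (ε(s) − 1/2)·τ, and |ε(s)| ≤ C|τ|. -/
open MeasureTheory Real

/-- The `ℓ`-th Taylor coefficient of `cauchyI` at `s = 1`. -/
noncomputable def cauchyTaylorCoeff (ℓ : ℕ) : ℝ :=
  iteratedDeriv ℓ cauchyI 1 / ℓ.factorial

open FormalMultilinearSeries in
/-- Averaging the dilates `x ↦ g (u y * x)`, `|u y| ≤ 1`, of a function given by a power series on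
the unit ball against an integrable weight yields a function given by a power series there. -/
lemma hasFPowerSeriesOnBall_integral_dilate {X : Type*} [MeasurableSpace X] {μ : Measure X}
    {g : ℝ → ℝ} {c : ℕ → ℝ} (hg : HasFPowerSeriesOnBall g (ofScalars ℝ c) 0 1)
    {w u : X → ℝ} (hw : Integrable w μ) (hu : AEStronglyMeasurable u μ) (hu1 : ∀ y, |u y| ≤ 1) :
    HasFPowerSeriesOnBall (fun x => ∫ y, w y * g (u y * x) ∂μ)
      (ofScalars ℝ fun n => c n * ∫ y, w y * u y ^ n ∂μ) 0 1 := by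
  have hpow (n : ℕ) : ∀ y, ‖u y ^ n‖ ≤ 1 := fun y => by
    rw [norm_pow]; exact pow_le_one₀ (norm_nonneg _) (hu1 y)
  have hint (n : ℕ) : Integrable (fun y => w y * u y ^ n) μ :=
    hw.mul_bdd (c := 1) (hu.pow n) (ae_of_all _ (hpow n))
  have hnorm (n : ℕ) : ∫ y, ‖w y * u y ^ n‖ ∂μ ≤ ∫ y, ‖w y‖ ∂μ :=
    integral_mono (hint n).norm hw.norm fun y => by
      rw [norm_mul]; exact mul_le_of_le_one_right (norm_nonneg _) (hpow n y)
  refine ⟨?_, one_pos, ?_⟩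
  · refine hg.r_le.trans (ENNReal.le_of_forall_nnreal_lt fun r hr => ?_)
    refine le_radius_of_summable _ (Summable.of_nonneg_of_le (fun n => by positivity) (fun n => ?_)
      ((summable_norm_mul_pow _ hr).mul_right (∫ y, ‖w y‖ ∂μ)))
    rw [ofScalars_norm, ofScalars_norm, norm_mul, mul_right_comm]
    gcongr
    exact (norm_integral_le_integral_norm _).trans (hnorm n)
  · intro x hx
    have hx1 : |x| < 1 := by
      simpa [enorm_eq_nnnorm, ← NNReal.coe_lt_coe] using hx
    have hsum : Summable fun n => |c n| * |x| ^ n := by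
      have h := summable_norm_mul_pow (ofScalars ℝ c) (r := ‖x‖₊)
        (lt_of_lt_of_le (by simpa [enorm_eq_nnnorm] using hx) hg.r_le)
      simpa [ofScalars_norm] using h
    have key := hasSum_integral_of_summable_integral_norm (μ := μ)
      (F := fun n y => c n * x ^ n * (w y * u y ^ n)) (fun n => (hint n).const_mul _) (by
        refine Summable.of_nonneg_of_le (fun n => integral_nonneg fun y => norm_nonneg _)
          (fun n => ?_) (hsum.mul_right (∫ y, ‖w y‖ ∂μ))
        simp_rw [norm_mul (c n * x ^ n), integral_const_mul]
        rw [norm_mul, norm_pow, Real.norm_eq_abs, Real.norm_eq_abs]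
        exact mul_le_mul_of_nonneg_left (hnorm n) (by positivity))
    have htsum (y : X) : ∑' n, c n * x ^ n * (w y * u y ^ n) = w y * g (u y * x) := by
      have hmem : u y * x ∈ Metric.eball (0 : ℝ) 1 := by
        have : |u y * x| < 1 := by
          rw [abs_mul]; exact (mul_le_of_le_one_left (abs_nonneg _) (hu1 y)).trans_lt hx1
        rwa [Metric.mem_eball, edist_zero_right, enorm_eq_nnnorm, ENNReal.coe_lt_one_iff,
          ← NNReal.coe_lt_one, coe_nnnorm, Real.norm_eq_abs]
      have h := (hg.hasSum hmem).mul_left (w y)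
      rw [zero_add] at h
      rw [← h.tsum_eq]
      congr 1 with n
      simp only [ofScalars_apply_eq, smul_eq_mul]
      ring
    simp_rw [htsum, integral_const_mul] at key
    simp only [ofScalars_apply_eq, smul_eq_mul, zero_add]
    convert key using 2 with n
    ring

lemma integrable_inv_sq_add_one : Integrable fun y : ℝ => (y ^ 2 + 1)⁻¹ := by
  simpa only [add_comm] using integrable_inv_one_add_sq

lemma cauchyI_eq_integral_rpow {s : ℝ} (hs : 0 < s) :
    cauchyI s = (1 / π) * ∫ y : ℝ,
      (y ^ 2 + 1)⁻¹ * (1 + (y ^ 2 + 1)⁻¹ * (s ^ 2 - 1)) ^ (-(1 / 2) : ℝ) := by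
  unfold cauchyI
  congr 2 with y
  have h1 : 0 < y ^ 2 + 1 := by positivity
  have h2 : 0 < y ^ 2 + s ^ 2 := by positivity
  have h3 : 1 + (y ^ 2 + 1)⁻¹ * (s ^ 2 - 1) = (y ^ 2 + s ^ 2) / (y ^ 2 + 1) := by
    field_simp; ring
  rw [h3, rpow_neg (by positivity), ← sqrt_eq_rpow, sqrt_div h2.le]
  have h4 := sqrt_pos.2 h1
  have h5 := sqrt_pos.2 h2
  nth_rewrite 2 [← mul_self_sqrt h1.le]
  field_simp

lemma analyticAt_cauchyI : AnalyticAt ℝ cauchyI 1 := by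
  have hG := hasFPowerSeriesOnBall_integral_dilate (μ := volume)
    (one_add_rpow_hasFPowerSeriesOnBall_zero (a := -(1 / 2))) integrable_inv_sq_add_one
    integrable_inv_sq_add_one.aestronglyMeasurable (fun y => by
      rw [abs_of_nonneg (by positivity)]
      exact inv_le_one_of_one_le₀ (by nlinarith [sq_nonneg y]))
  have h0 : AnalyticAt ℝ (fun s : ℝ => s ^ 2 - 1) 1 := by fun_prop
  have h1 : AnalyticAt ℝ (fun x : ℝ => ∫ y : ℝ,
      (y ^ 2 + 1)⁻¹ * (1 + (y ^ 2 + 1)⁻¹ * x) ^ (-(1 / 2) : ℝ)) ((1 : ℝ) ^ 2 - 1) := by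
    simpa using hG.analyticAt
  refine ((analyticAt_const (v := 1 / π)).mul
    (AnalyticAt.fun_comp (f := fun s : ℝ => s ^ 2 - 1) h1 h0)).congr ?_
  filter_upwards [lt_mem_nhds one_pos] with s hs
  exact (cauchyI_eq_integral_rpow hs).symm

lemma cauchyI_inv {s : ℝ} (hs : 0 < s) : cauchyI s⁻¹ = s * cauchyI s := by
  have h := Measure.integral_comp_mul_left
    (fun y : ℝ => 1 / (√(y ^ 2 + 1) * √(y ^ 2 + s ^ 2))) s
  have h' : ∀ y : ℝ, 1 / (√((s * y) ^ 2 + 1) * √((s * y) ^ 2 + s ^ 2)) =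
      s⁻¹ ^ 2 * (1 / (√(y ^ 2 + 1) * √(y ^ 2 + s⁻¹ ^ 2))) := fun y => by
    have e1 : (s * y) ^ 2 + 1 = s ^ 2 * (y ^ 2 + s⁻¹ ^ 2) := by field_simp
    have e2 : (s * y) ^ 2 + s ^ 2 = s ^ 2 * (y ^ 2 + 1) := by ring
    rw [e1, e2, sqrt_mul (by positivity), sqrt_mul (by positivity), sqrt_sq hs.le]
    field_simp
  simp_rw [h', integral_const_mul, abs_of_pos (inv_pos.2 hs), smul_eq_mul] at h
  rw [cauchyI, cauchyI]
  field_simp at h ⊢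
  linarith

lemma deriv_cauchyI_one : deriv cauchyI 1 = -1 / 2 := by
  have hd : HasDerivAt cauchyI (deriv cauchyI 1) 1 :=
    analyticAt_cauchyI.differentiableAt.hasDerivAt
  have hl : HasDerivAt (fun s => cauchyI s⁻¹) (deriv cauchyI 1 * (-(1 ^ 2)⁻¹)) 1 :=
    HasDerivAt.comp (h₂ := cauchyI) (1 : ℝ) (by simpa using hd) (hasDerivAt_inv one_ne_zero)
  have hr : HasDerivAt (fun s => s * cauchyI s) (1 * cauchyI 1 + 1 * deriv cauchyI 1) 1 :=
    (hasDerivAt_id' (1 : ℝ)).mul hd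
  have he : (fun s => cauchyI s⁻¹) =ᶠ[nhds 1] fun s => s * cauchyI s := by
    filter_upwards [lt_mem_nhds one_pos] with s hs using cauchyI_inv hs
  have := hl.unique (hr.congr_of_eventuallyEq he)
  rw [cauchyI_one] at this
  norm_num at this
  linarith

theorem cauchyI_series_representation :
    ∃ α : ℝ, α ∈ Set.Ioo (0 : ℝ) 1 ∧ ∃ C : ℝ, 0 < C ∧
      ∀ s : ℝ, 0 < s → s ≠ 1 → |s - 1| < α →
        Summable (fun ℓ : ℕ => |cauchyTaylorCoeff (ℓ + 2) * (s - 1) ^ (ℓ + 1)|) ∧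
        cauchyI s =
          1 + ((∑' ℓ : ℕ, cauchyTaylorCoeff (ℓ + 2) * (s - 1) ^ (ℓ + 1)) - 1 / 2)
            * (s - 1) ∧
        |∑' ℓ : ℕ, cauchyTaylorCoeff (ℓ + 2) * (s - 1) ^ (ℓ + 1)| ≤ C * |s - 1| := by
  obtain ⟨R, hR⟩ := analyticAt_cauchyI.hasFPowerSeriesAt
  change HasFPowerSeriesOnBall cauchyI
    (FormalMultilinearSeries.ofScalars ℝ cauchyTaylorCoeff) 1 R at hR
  obtain ⟨r, hr0, hrR⟩ := ENNReal.lt_iff_exists_nnreal_btwn.1 hR.r_pos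
  have hr0' : (0 : ℝ) < r := by exact_mod_cast hr0
  have hsum : Summable fun n => |cauchyTaylorCoeff n| * (r : ℝ) ^ n := by
    simpa [FormalMultilinearSeries.ofScalars_norm] using
      FormalMultilinearSeries.summable_norm_mul_pow _ (hrR.trans_le hR.r_le)
  have hsum2 : Summable fun n => |cauchyTaylorCoeff (n + 2)| * (r : ℝ) ^ n := by
    refine (((summable_nat_add_iff 2).2 hsum).mul_right ((r : ℝ) ^ 2)⁻¹).congr fun n => ?_
    rw [pow_add]; field_simp
  set S := ∑' n, |cauchyTaylorCoeff (n + 2)| * (r : ℝ) ^ n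
  have hS : 0 ≤ S := tsum_nonneg fun n => by positivity
  refine ⟨min r (1 / 2), ⟨by positivity, (min_le_right _ _).trans_lt (by norm_num)⟩, S + 1,
    by positivity, fun s _ _ hs => ?_⟩
  have hsr : |s - 1| < r := hs.trans_le (min_le_left _ _)
  have hle (n : ℕ) : |cauchyTaylorCoeff (n + 2) * (s - 1) ^ (n + 1)| ≤
      |cauchyTaylorCoeff (n + 2)| * (r : ℝ) ^ n * |s - 1| := by
    rw [abs_mul, abs_pow, pow_succ, ← mul_assoc]
    gcongr
  have hsumm : Summable fun n => |cauchyTaylorCoeff (n + 2) * (s - 1) ^ (n + 1)| :=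
    .of_nonneg_of_le (fun n => abs_nonneg _) hle (hsum2.mul_right _)
  refine ⟨hsumm, ?_, ?_⟩
  · have hmem : s - 1 ∈ Metric.eball (0 : ℝ) R := by
      refine Metric.eball_subset_eball hrR.le ?_
      simpa [enorm_eq_nnnorm, ← NNReal.coe_lt_coe] using hsr
    have h := hR.hasSum hmem
    simp only [FormalMultilinearSeries.ofScalars_apply_eq, smul_eq_mul, add_sub_cancel] at h
    rw [← h.tsum_eq, ← h.summable.sum_add_tsum_nat_add 2, Finset.sum_range_succ,
      Finset.sum_range_one, sub_mul, ← tsum_mul_right]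
    have h0 : cauchyTaylorCoeff 0 = 1 := by simp [cauchyTaylorCoeff, cauchyI_one]
    have h1 : cauchyTaylorCoeff 1 = -1 / 2 := by
      simp [cauchyTaylorCoeff, iteratedDeriv_one, deriv_cauchyI_one]
    simp_rw [h0, h1, mul_assoc, ← pow_succ]
    ring
  · calc |∑' n, cauchyTaylorCoeff (n + 2) * (s - 1) ^ (n + 1)|
        ≤ ∑' n, |cauchyTaylorCoeff (n + 2) * (s - 1) ^ (n + 1)| :=
          norm_tsum_le_tsum_norm (f := fun n => cauchyTaylorCoeff (n + 2) * (s - 1) ^ (n + 1)) hsumm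
      _ ≤ ∑' n, |cauchyTaylorCoeff (n + 2)| * (r : ℝ) ^ n * |s - 1| :=
          hsumm.tsum_le_tsum hle (hsum2.mul_right _)
      _ = S * |s - 1| := tsum_mul_right
      _ ≤ (S + 1) * |s - 1| := by gcongr; linarith
end
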